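/- arXiv:2405.10710 — 3 statements merged into one kernel-verified Lean document; each statement's English description precedes it below -/
import Mathlib

section
/- Let q be an even prime power and F = GF(q). Let y = (y0,...,y5) ∈ F^6 be nonzero with rank(M_y) = 2 and with (y0,y3,y5) ≠ (0,0,0). Then among the conics of the squab S_y there are exactly q+1 double lines, exactly (q^3+3q^2+q)/2 pairs of real lines, exactly (q^3+q^2−q)/2 pairs of imaginary lines, and exactly q^4−q^2 nonsingular conics. -/
open Matrix

namespace Conics

/-- Coefficient vector (a0,...,a5) of the product of two linear forms
`(b0*X0+b1*X1+b2*X2)*(c0*X0+c1*X1+c2*X2)`, where the quadratic form with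
coefficient vector `a` is `a0*X0^2 + a1*X0*X1 + a2*X0*X2 + a3*X1^2 + a4*X1*X2 + a5*X2^2`. -/
def mulLin {F : Type} [Field F] (b c : Fin 3 → F) : Fin 6 → F :=
  ![b 0 * c 0, b 0 * c 1 + b 1 * c 0, b 0 * c 2 + b 2 * c 0,
    b 1 * c 1, b 1 * c 2 + b 2 * c 1, b 2 * c 2]

/-- The discriminant of the quadratic form with coefficient vector `a`. -/
def disc {F : Type} [Field F] (a : Fin 6 → F) : F :=
  4 * a 0 * a 3 * a 5 + a 1 * a 2 * a 4 - a 0 * a 4 ^ 2 - a 3 * a 2 ^ 2 - a 5 * a 1 ^ 2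

/-- `f_a` is a double line: `f_a = c * l^2` for a nonzero scalar `c` and nonzero linear form `l`. -/
def IsDoubleLine {F : Type} [Field F] (a : Fin 6 → F) : Prop :=
  ∃ (c : F) (l : Fin 3 → F), c ≠ 0 ∧ l ≠ 0 ∧ a = c • mulLin l l

/-- `f_a` is a pair of (distinct) real lines: `f_a = l1 * l2` with neither linear form a scalar
multiple of the other. -/
def IsRealPair {F : Type} [Field F] (a : Fin 6 → F) : Prop :=
  ∃ l1 l2 : Fin 3 → F, (¬ ∃ t : F, l2 = t • l1) ∧ (¬ ∃ t : F, l1 = t • l2) ∧ a = mulLin l1 l2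

/-- `f_a` is a pair of conjugate imaginary lines: singular, but not a product of two linear
forms over `F`. -/
def IsImagPair {F : Type} [Field F] (a : Fin 6 → F) : Prop :=
  disc a = 0 ∧ ¬ ∃ l1 l2 : Fin 3 → F, a = mulLin l1 l2

/-- `f_a` is a nonsingular conic. -/
def IsNonsingular {F : Type} [Field F] (a : Fin 6 → F) : Prop :=
  disc a ≠ 0

/-- The number of conics of a given type `T` in a linear system `W` (a subspace of the space of
quadratic forms, identified with `F^6`): the number of 1-dimensional subspaces `⟨a⟩` of `W`,
`a ≠ 0`, such that `f_a` has type `T`. -/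
noncomputable def numConics {F : Type} [Field F] (W : Submodule F (Fin 6 → F))
    (T : (Fin 6 → F) → Prop) : ℕ :=
  Set.ncard {P : Submodule F (Fin 6 → F) |
    ∃ a : Fin 6 → F, a ≠ 0 ∧ a ∈ W ∧ T a ∧ P = Submodule.span F {a}}

/-- The symmetric 3×3 matrix associated with a point `y` of `PG(5,q)`. -/
def M {F : Type} [Field F] (y : Fin 6 → F) : Matrix (Fin 3) (Fin 3) F :=
  !![y 0, y 1, y 2; y 1, y 3, y 4; y 2, y 4, y 5]

/-- The pairing `B(a,y) = a0*y0 + ... + a5*y5`. -/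
def Bform {F : Type} [Field F] (a y : Fin 6 → F) : F :=
  a 0 * y 0 + a 1 * y 1 + a 2 * y 2 + a 3 * y 3 + a 4 * y 4 + a 5 * y 5

/-- The squab of conics associated with a (nonzero) point `y`: the hyperplane
`{a : B(a,y) = 0}` of the space of quadratic forms. -/
def squab {F : Type} [Field F] (y : Fin 6 → F) : Submodule F (Fin 6 → F) where
  carrier := {a | Bform a y = 0}
  add_mem' := by
    intro a b ha hb
    simp only [Set.mem_setOf_eq, Bform, Pi.add_apply] at *
    linear_combination ha + hb
  zero_mem' := by simp [Bform]
  smul_mem' := by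
    intro c a ha
    simp only [Set.mem_setOf_eq, Bform, Pi.smul_apply, smul_eq_mul] at *
    linear_combination c * ha

section aux
open Classical

lemma card_fib {F V W : Type} [Field F] [AddCommGroup V] [Module F V] [AddCommGroup W] [Module F W]
    [Fintype V] [Fintype W] (f : V →ₗ[F] W) (hf : Function.Surjective f) (c : W) :
    (Finset.univ.filter fun v => f v = c).card * Fintype.card W = Fintype.card V := by
  have h1 : ∀ c' : W, (Finset.univ.filter fun v => f v = c').card
      = (Finset.univ.filter fun v => f v = c).card := by
    intro c'
    obtain ⟨v0, hv0⟩ := hf c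
    obtain ⟨v1, hv1⟩ := hf c'
    refine Finset.card_bij' (fun v _ => v - v1 + v0) (fun v _ => v - v0 + v1) ?_ ?_ ?_ ?_
    all_goals intro v hv
    all_goals simp_all
  have h2 := Finset.card_eq_sum_card_fiberwise (f := f) (s := (Finset.univ : Finset V))
    (t := (Finset.univ : Finset W)) (by simp)
  rw [Finset.sum_congr rfl (fun b _ => h1 b)] at h2
  simp only [Finset.sum_const, Finset.card_univ, smul_eq_mul] at h2
  rw [h2, mul_comm]

/-- dot product functional -/
def dotL {F : Type} [Field F] (w : Fin 3 → F) : (Fin 3 → F) →ₗ[F] F where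
  toFun x := w 0 * x 0 + w 1 * x 1 + w 2 * x 2
  map_add' x y := by simp; ring
  map_smul' c x := by simp; ring

lemma dotL_apply {F : Type} [Field F] (w x : Fin 3 → F) :
    dotL w x = w 0 * x 0 + w 1 * x 1 + w 2 * x 2 := rfl

lemma dotL_surj {F : Type} [Field F] (w : Fin 3 → F) (hw : w ≠ 0) :
    Function.Surjective (dotL w) := by
  intro c
  obtain ⟨i, hi⟩ := Function.ne_iff.mp hw
  simp only [Pi.zero_apply] at hi
  refine ⟨Pi.single i (c / w i), ?_⟩
  rw [dotL_apply]
  fin_cases i <;> simp at hi ⊢ <;> field_simp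

lemma card_dot {F : Type} [Field F] [Fintype F] (w : Fin 3 → F) (hw : w ≠ 0) (c : F) :
    (Finset.univ.filter fun x => dotL w x = c).card = Fintype.card F ^ 2 := by
  have h := card_fib (dotL w) (dotL_surj w hw) c
  have : 0 < Fintype.card F := Fintype.card_pos
  simp only [Fintype.card_fun, Fintype.card_fin] at h
  have h3 : (Finset.univ.filter fun x => dotL w x = c).card * Fintype.card F
    = Fintype.card F ^ 2 * Fintype.card F := by rw [h]; ring
  exact Nat.eq_of_mul_eq_mul_right this h3

lemma dot2_surj {F : Type} [Field F] (w z : Fin 3 → F) (hw : w ≠ 0) (hz : ¬ ∃ t : F, z = t • w) :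
    Function.Surjective ((dotL w).prod (dotL z)) := by
  rw [← LinearMap.range_eq_top]
  by_contra hne
  obtain ⟨φ, hφ, hle⟩ := Submodule.exists_le_ker_of_lt_top _ (lt_top_iff_ne_top.mpr hne)
  have hdec : ∀ p : F × F, φ p = p.1 * φ (1, 0) + p.2 * φ (0, 1) := by
    rintro ⟨a, b⟩
    have : ((a, b) : F × F) = a • (1, 0) + b • (0, 1) := by simp
    rw [this, map_add, map_smul, map_smul]; simp
  have hk : ∀ x, dotL w x * φ (1, 0) + dotL z x * φ (0, 1) = 0 := by
    intro x
    have := hle (LinearMap.mem_range_self ((dotL w).prod (dotL z)) x)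
    rw [LinearMap.mem_ker, hdec] at this
    simpa using this
  have hk' : ∀ i, w i * φ (1, 0) + z i * φ (0, 1) = 0 := by
    intro i
    have := hk (Pi.single i 1)
    simp only [dotL_apply] at this
    fin_cases i <;> simpa using this
  by_cases hb : φ (0, 1) = 0
  · have ha : φ (1, 0) ≠ 0 := by
      intro ha
      apply hφ
      ext <;> simp [ha, hb]
    apply hw
    ext i
    have := hk' i
    simpa [hb, ha] using this
  · apply hz
    refine ⟨- φ (1, 0) / φ (0, 1), ?_⟩
    ext i
    have := hk' i
    simp only [Pi.smul_apply, smul_eq_mul]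
    field_simp
    linear_combination this

lemma card_dot2 {F : Type} [Field F] [Fintype F] (w z : Fin 3 → F) (hw : w ≠ 0)
    (hz : ¬ ∃ t : F, z = t • w) (c d : F) :
    (Finset.univ.filter fun x => dotL w x = c ∧ dotL z x = d).card = Fintype.card F := by
  have h := card_fib ((dotL w).prod (dotL z)) (dot2_surj w z hw hz) (c, d)
  have hp : 0 < Fintype.card F := Fintype.card_pos
  simp only [Fintype.card_fun, Fintype.card_fin, Fintype.card_prod, LinearMap.prod_apply,
    Function.prod, Prod.mk.injEq] at h
  have h3 : (Finset.univ.filter fun x => dotL w x = c ∧ dotL z x = d).card *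
    (Fintype.card F * Fintype.card F) = Fintype.card F * (Fintype.card F * Fintype.card F) := by
    rw [h]; ring
  exact Nat.eq_of_mul_eq_mul_right (by positivity) h3

/-- number of vectors versus number of points -/
lemma numConics_mul {F : Type} [Field F] [Fintype F] (W : Submodule F (Fin 6 → F))
    (T : (Fin 6 → F) → Prop) (hT : ∀ (u : F) a, u ≠ 0 → T a → T (u • a)) :
    (Finset.univ.filter fun a : Fin 6 → F => a ≠ 0 ∧ a ∈ W ∧ T a).card
      = numConics W T * (Fintype.card F - 1) := by
  set S := Finset.univ.filter fun a : Fin 6 → F => a ≠ 0 ∧ a ∈ W ∧ T a with hS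
  have himg : {P : Submodule F (Fin 6 → F) |
    ∃ a : Fin 6 → F, a ≠ 0 ∧ a ∈ W ∧ T a ∧ P = Submodule.span F {a}}
      = (S.image fun a => Submodule.span F {a} : Finset (Submodule F (Fin 6 → F))) := by
    ext P
    simp only [hS, Set.mem_setOf_eq, Finset.coe_image, Set.mem_image, Finset.mem_coe,
      Finset.mem_filter, Finset.mem_univ, true_and, and_assoc]
    constructor
    · rintro ⟨a, h1, h2, h3, h4⟩; exact ⟨a, h1, h2, h3, h4.symm⟩
    · rintro ⟨a, h1, h2, h3, h4⟩; exact ⟨a, h1, h2, h3, h4.symm⟩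
  unfold numConics
  rw [himg, Set.ncard_coe_finset]
  rw [Finset.card_eq_sum_card_image (fun a => Submodule.span F {a}) S]
  rw [Finset.sum_const_nat (m := Fintype.card F - 1)]
  intro P hP
  obtain ⟨a, ha, rfl⟩ := Finset.mem_image.mp hP
  obtain ⟨h0, hW, hTa⟩ : a ≠ 0 ∧ a ∈ W ∧ T a := by simpa [hS] using ha
  have : (S.filter fun b => Submodule.span F {b} = Submodule.span F {a})
      = (Finset.univ.erase (0 : F)).image fun u => u • a := by
    ext b
    simp only [hS, Finset.mem_filter, Finset.mem_univ, true_and, Finset.mem_image,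
      Finset.mem_erase, and_true]
    constructor
    · rintro ⟨⟨hb0, -, -⟩, hsp⟩
      have : b ∈ Submodule.span F {a} := hsp ▸ Submodule.mem_span_singleton_self b
      obtain ⟨u, rfl⟩ := Submodule.mem_span_singleton.mp this
      exact ⟨u, fun h => hb0 (by simp [h]), rfl⟩
    · rintro ⟨u, hu, rfl⟩
      exact ⟨⟨smul_ne_zero hu h0, W.smul_mem u hW, hT u a hu hTa⟩,
        Submodule.span_singleton_smul_eq (IsUnit.mk0 u hu) a⟩
  rw [this, Finset.card_image_of_injective _ (smul_left_injective F h0),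
    Finset.card_erase_of_mem (Finset.mem_univ _), Finset.card_univ]

lemma char_two {F : Type} [Field F] [Fintype F] (h : Even (Fintype.card F)) : CharP F 2 := by
  have : ringChar F = 2 := FiniteField.even_card_iff_char_two.mpr (Nat.even_iff.mp h)
  rw [← this]; infer_instance

lemma ex_sqrt {F : Type} [Field F] [Fintype F] (h : Even (Fintype.card F)) (a : F) :
    ∃ r, a = r ^ 2 := by
  have : ringChar F = 2 := FiniteField.even_card_iff_char_two.mpr (Nat.even_iff.mp h)
  obtain ⟨r, hr⟩ := FiniteField.isSquare_of_char_two this a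
  exact ⟨r, by rw [hr, sq]⟩

/-- split coordinates as (nucleus part, diagonal part) -/
def spl (F : Type) : ((Fin 3 → F) × (Fin 3 → F)) ≃ (Fin 6 → F) where
  toFun p := ![p.2 0, p.1 2, p.1 1, p.2 1, p.1 0, p.2 2]
  invFun a := (![a 4, a 2, a 1], ![a 0, a 3, a 5])
  left_inv p := by
    ext i <;> fin_cases i <;> rfl
  right_inv a := by
    ext i; fin_cases i <;> rfl

lemma card_spl {F : Type} [Fintype F] (P : (Fin 6 → F) → Prop) [DecidablePred P] :
    (Finset.univ.filter P).card
      = ∑ n : Fin 3 → F, (Finset.univ.filter fun d => P (spl F (n, d))).card := by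
  simp only [Finset.card_filter]
  rw [← (spl F).sum_comp, Fintype.sum_prod_type]

lemma card_pair {A B : Type} [Fintype A] [Fintype B] (P : A × B → Prop) [DecidablePred P] :
    (Finset.univ.filter P).card
      = ∑ n : A, (Finset.univ.filter fun d => P (n, d)).card := by
  simp only [Finset.card_filter]
  rw [Fintype.sum_prod_type]

lemma sum_ite_card {A : Type} [Fintype A] (P : A → Prop) [DecidablePred P] (x y : ℕ) :
    ∑ a : A, (if P a then x else y) = (Finset.univ.filter P).card * x
      + (Fintype.card A - (Finset.univ.filter P).card) * y := by
  rw [Finset.sum_ite]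
  simp only [Finset.sum_const, smul_eq_mul]
  congr 2
  have := Finset.card_filter_add_card_filter_not (s := (Finset.univ : Finset A)) P
  rw [Finset.card_univ] at this
  omega

lemma card_prop {F : Type} [Field F] [Fintype F] (h : Even (Fintype.card F)) (w : Fin 3 → F)
    (hw : w ≠ 0) :
    (Finset.univ.filter fun n : Fin 3 → F => ∃ t : F, (fun i => n i ^ 2) = t • w).card
      = Fintype.card F := by
  have hc : CharP F 2 := char_two h
  choose r hr using fun i => ex_sqrt h (w i)
  have hr0 : r ≠ 0 := by
    rintro rfl
    apply hw
    ext i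
    rw [hr i]; simp
  have : (Finset.univ.filter fun n : Fin 3 → F => ∃ t : F, (fun i => n i ^ 2) = t • w)
      = Finset.univ.image fun s : F => s • r := by
    ext n
    simp only [Finset.mem_filter, Finset.mem_univ, true_and, Finset.mem_image]
    constructor
    · rintro ⟨t, ht⟩
      obtain ⟨s, rfl⟩ := ex_sqrt h t
      refine ⟨s, ?_⟩
      ext i
      have := congrFun ht i
      simp only [Pi.smul_apply, smul_eq_mul, hr i] at this ⊢
      rw [← mul_pow] at this
      have h2 : (s * r i - n i) ^ 2 = 0 := by
        rw [CharTwo.sub_eq_add, CharTwo.add_sq, this, CharTwo.add_self_eq_zero]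
      exact sub_eq_zero.mp (pow_eq_zero_iff (two_ne_zero) |>.mp h2)
    · rintro ⟨s, rfl⟩
      refine ⟨s ^ 2, ?_⟩
      ext i
      simp only [Pi.smul_apply, smul_eq_mul, hr i]
      ring
  rw [this, Finset.card_image_of_injective _ (smul_left_injective F hr0), Finset.card_univ]

lemma card_sing {F : Type} [Field F] [Fintype F] (h : Even (Fintype.card F)) (y : Fin 6 → F)
    (hdet : (M y).det = 0) (hns : ¬ (y 0 = 0 ∧ y 3 = 0 ∧ y 5 = 0)) :
    (Finset.univ.filter fun a : Fin 6 → F => Bform a y = 0 ∧ disc a = 0).card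
      = Fintype.card F * Fintype.card F ^ 2
        + (Fintype.card F ^ 3 - Fintype.card F) * Fintype.card F := by
  have hc : CharP F 2 := char_two h
  have h2 : (2 : F) = 0 := CharTwo.two_eq_zero
  have hw : (![y 0, y 3, y 5] : Fin 3 → F) ≠ 0 := by
    intro hw
    exact hns ⟨congrFun hw 0, congrFun hw 1, congrFun hw 2⟩
  rw [card_spl]
  have key : ∀ n : Fin 3 → F,
      (Finset.univ.filter fun d => Bform (spl F (n, d)) y = 0 ∧ disc (spl F (n, d)) = 0).card
      = if ∃ t : F, (fun i => n i ^ 2) = t • (![y 0, y 3, y 5] : Fin 3 → F)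
        then Fintype.card F ^ 2 else Fintype.card F := by
    intro n
    have hB : ∀ d, Bform (spl F (n, d)) y = 0 ↔
        dotL ![y 0, y 3, y 5] d = -(y 1 * n 2 + y 2 * n 1 + y 4 * n 0) := by
      intro d
      have : Bform (spl F (n, d)) y = d 0 * y 0 + n 2 * y 1 + n 1 * y 2 + d 1 * y 3 + n 0 * y 4
        + d 2 * y 5 := rfl
      rw [this, eq_neg_iff_add_eq_zero]
      have e : dotL ![y 0, y 3, y 5] d = y 0 * d 0 + y 3 * d 1 + y 5 * d 2 := rfl
      rw [e]
      constructor <;> intro hh <;> linear_combination hh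
    have hD : ∀ d, disc (spl F (n, d)) = 0 ↔
        dotL (fun i => n i ^ 2) d = n 0 * n 1 * n 2 := by
      intro d
      have : disc (spl F (n, d)) = 4 * d 0 * d 1 * d 2 + n 2 * n 1 * n 0 - d 0 * n 0 ^ 2
        - d 1 * n 1 ^ 2 - d 2 * n 2 ^ 2 := rfl
      rw [this]
      have e : dotL (fun i => n i ^ 2) d = n 0 ^ 2 * d 0 + n 1 ^ 2 * d 1 + n 2 ^ 2 * d 2 := rfl
      rw [e]
      constructor
      · intro hh; linear_combination - hh + 2 * d 0 * d 1 * d 2 * h2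
      · intro hh; linear_combination - hh + 2 * d 0 * d 1 * d 2 * h2
    simp only [hB, hD]
    split_ifs with ht
    · obtain ⟨t, ht⟩ := ht
      rw [← card_dot _ hw (-(y 1 * n 2 + y 2 * n 1 + y 4 * n 0))]
      congr 1
      ext d
      simp only [Finset.mem_filter, Finset.mem_univ, true_and, and_iff_left_iff_imp]
      intro hd
      rw [ht]
      have e : dotL (t • ![y 0, y 3, y 5]) d = t * dotL ![y 0, y 3, y 5] d := by
        simp [dotL_apply]; ring
      rw [e, hd]
      have t0 : n 0 ^ 2 = t * y 0 := congrFun ht 0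
      have t1 : n 1 ^ 2 = t * y 3 := congrFun ht 1
      have t2 : n 2 ^ 2 = t * y 5 := congrFun ht 2
      have hdet' : y 0 * y 3 * y 5 + y 0 * y 4 ^ 2 + y 3 * y 2 ^ 2 + y 5 * y 1 ^ 2 = 0 := by
        rw [M, Matrix.det_fin_three] at hdet
        simp at hdet
        linear_combination hdet + (y 0 * y 4 ^ 2 + y 3 * y 2 ^ 2 + y 5 * y 1 ^ 2
          - y 1 * y 2 * y 4) * h2
      have hs : (t * -(y 1 * n 2 + y 2 * n 1 + y 4 * n 0) - n 0 * n 1 * n 2) ^ 2 = 0 := by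
        have : (t * -(y 1 * n 2 + y 2 * n 1 + y 4 * n 0) - n 0 * n 1 * n 2) ^ 2
          = t ^ 2 * (y 1 ^ 2 * n 2 ^ 2 + y 2 ^ 2 * n 1 ^ 2 + y 4 ^ 2 * n 0 ^ 2)
            + n 0 ^ 2 * n 1 ^ 2 * n 2 ^ 2 := by
          linear_combination (t ^ 2 * (y 1 * n 2 * y 2 * n 1 + y 1 * n 2 * y 4 * n 0
            + y 2 * n 1 * y 4 * n 0) + t * (y 1 * n 2 + y 2 * n 1 + y 4 * n 0) *
              (n 0 * n 1 * n 2)) * h2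
        rw [this, t0, t1, t2]
        linear_combination t ^ 3 * hdet'
      exact sub_eq_zero.mp (pow_eq_zero_iff (two_ne_zero) |>.mp hs)
    · exact card_dot2 _ _ hw ht _ _
  rw [Finset.sum_congr rfl (fun n _ => key n), sum_ite_card, card_prop h _ hw]
  simp

lemma double_iff {F : Type} [Field F] [Fintype F] (h : Even (Fintype.card F)) (a : Fin 6 → F)
    (ha : a ≠ 0) : IsDoubleLine a ↔ a 1 = 0 ∧ a 2 = 0 ∧ a 4 = 0 := by
  have hc : CharP F 2 := char_two h
  constructor
  · rintro ⟨c, l, -, -, rfl⟩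
    have hx : ∀ x : F, x + x = 0 := fun x => CharTwo.add_self_eq_zero x
    refine ⟨?_, ?_, ?_⟩ <;> simp [mulLin, mul_comm, hx]
  · rintro ⟨h1, h2, h4⟩
    obtain ⟨r0, hr0⟩ := ex_sqrt h (a 0)
    obtain ⟨r3, hr3⟩ := ex_sqrt h (a 3)
    obtain ⟨r5, hr5⟩ := ex_sqrt h (a 5)
    have e : a = (1 : F) • mulLin ![r0, r3, r5] ![r0, r3, r5] := by
      have hx : ∀ x : F, x + x = 0 := fun x => CharTwo.add_self_eq_zero x
      ext i
      fin_cases i <;> simp [mulLin, h1, h2, h4, hr0, hr3, hr5, sq, mul_comm, hx]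
    refine ⟨1, ![r0, r3, r5], one_ne_zero, ?_, e⟩
    intro h0
    apply ha
    rw [e, h0]
    ext i; fin_cases i <;> simp [mulLin]

lemma card_double {F : Type} [Field F] [Fintype F] (h : Even (Fintype.card F)) (y : Fin 6 → F)
    (hns : ¬ (y 0 = 0 ∧ y 3 = 0 ∧ y 5 = 0)) :
    (Finset.univ.filter fun a : Fin 6 → F => a ≠ 0 ∧ a ∈ squab y ∧ IsDoubleLine a).card
      = Fintype.card F ^ 2 - 1 := by
  have hw : (![y 0, y 3, y 5] : Fin 3 → F) ≠ 0 := by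
    intro hw
    exact hns ⟨congrFun hw 0, congrFun hw 1, congrFun hw 2⟩
  have e1 : ((Finset.univ.filter fun d => dotL ![y 0, y 3, y 5] d = 0).erase 0).card
      = Fintype.card F ^ 2 - 1 := by
    rw [Finset.card_erase_of_mem (by simp), card_dot _ hw]
  rw [← e1]
  refine Finset.card_bij' (fun a _ => ![a 0, a 3, a 5]) (fun d _ => ![d 0, 0, 0, d 1, 0, d 2])
    ?_ ?_ ?_ ?_
  · intro a ha
    simp only [Finset.mem_filter, Finset.mem_univ, true_and] at ha
    obtain ⟨h0, hW, hD⟩ := ha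
    rw [double_iff h a h0] at hD
    obtain ⟨h1, h2, h4⟩ := hD
    simp only [Finset.mem_erase, Finset.mem_filter, Finset.mem_univ, true_and]
    constructor
    · intro hh
      have z0 : a 0 = 0 := congrFun hh 0
      have z1 : a 3 = 0 := congrFun hh 1
      have z2 : a 5 = 0 := congrFun hh 2
      apply h0
      ext i; fin_cases i <;> simp [*]
    · have hW' : a 0 * y 0 + a 1 * y 1 + a 2 * y 2 + a 3 * y 3 + a 4 * y 4 + a 5 * y 5 = 0 := hW
      rw [h1, h2, h4] at hW'
      have : dotL ![y 0, y 3, y 5] ![a 0, a 3, a 5] = y 0 * a 0 + y 3 * a 3 + y 5 * a 5 := rfl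
      rw [this]
      linear_combination hW'
  · intro d hd
    simp only [Finset.mem_erase, Finset.mem_filter, Finset.mem_univ, true_and] at hd
    obtain ⟨h0, hd⟩ := hd
    have hn : (![d 0, 0, 0, d 1, 0, d 2] : Fin 6 → F) ≠ 0 := by
      intro hh
      have z0 : d 0 = 0 := congrFun hh 0
      have z1 : d 1 = 0 := congrFun hh 3
      have z2 : d 2 = 0 := congrFun hh 5
      apply h0
      ext i; fin_cases i <;> simp [*]
    simp only [Finset.mem_filter, Finset.mem_univ, true_and]
    refine ⟨hn, ?_, ?_⟩
    · change d 0 * y 0 + 0 * y 1 + 0 * y 2 + d 1 * y 3 + 0 * y 4 + d 2 * y 5 = 0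
      have : dotL ![y 0, y 3, y 5] d = y 0 * d 0 + y 3 * d 1 + y 5 * d 2 := rfl
      rw [this] at hd
      linear_combination hd
    · rw [double_iff h _ hn]
      exact ⟨rfl, rfl, rfl⟩
  · intro a ha
    simp only [Finset.mem_filter, Finset.mem_univ, true_and] at ha
    obtain ⟨h0, hW, hD⟩ := ha
    rw [double_iff h a h0] at hD
    obtain ⟨h1, h2, h4⟩ := hD
    ext i; fin_cases i <;> simp [*]
  · intro d hd
    ext i; fin_cases i <;> simp

lemma mulLin_comm {F : Type} [Field F] (b c : Fin 3 → F) : mulLin b c = mulLin c b := by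
  ext i; fin_cases i <;> simp [mulLin] <;> ring

lemma mulLin_smul {F : Type} [Field F] (u : F) (b c : Fin 3 → F) :
    mulLin (u • b) c = u • mulLin b c := by
  ext i; fin_cases i <;> simp [mulLin] <;> ring

lemma mulLin_smul_right {F : Type} [Field F] (u : F) (b c : Fin 3 → F) :
    mulLin b (u • c) = u • mulLin b c := by
  ext i; fin_cases i <;> simp [mulLin] <;> ring

lemma mulLin_sub {F : Type} [Field F] (b c d : Fin 3 → F) :
    mulLin b (c - d) = mulLin b c - mulLin b d := by
  ext i; fin_cases i <;> simp [mulLin] <;> ring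

lemma mulLin_eq_zero {F : Type} [Field F] (b c : Fin 3 → F) (hb : b ≠ 0)
    (h : mulLin b c = 0) : c = 0 := by
  have e0 : b 0 * c 0 = 0 := congrFun h 0
  have e1 : b 0 * c 1 + b 1 * c 0 = 0 := congrFun h 1
  have e2 : b 0 * c 2 + b 2 * c 0 = 0 := congrFun h 2
  have e3 : b 1 * c 1 = 0 := congrFun h 3
  have e4 : b 1 * c 2 + b 2 * c 1 = 0 := congrFun h 4
  have e5 : b 2 * c 2 = 0 := congrFun h 5
  obtain ⟨k, hk⟩ := Function.ne_iff.mp hb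
  fin_cases k <;> simp at hk <;> ext i <;> fin_cases i <;> simp_all

lemma prop_of_ker {F : Type} [Field F] (l m : Fin 3 → F) (hl : l ≠ 0)
    (h : ∀ x, dotL l x = 0 → dotL m x = 0) : ∃ u : F, m = u • l := by
  by_contra hm
  obtain ⟨x, hx⟩ := dot2_surj l m hl hm (0, 1)
  have h1 : dotL l x = 0 := congrArg Prod.fst hx
  have h2 : dotL m x = 1 := congrArg Prod.snd hx
  rw [h x h1] at h2
  exact zero_ne_one h2

lemma mulLin_eval {F : Type} [Field F] (b c : Fin 3 → F) (x z : Fin 3 → F) :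
    dotL b x * dotL c z + dotL b z * dotL c x =
      2 * mulLin b c 0 * x 0 * z 0 + mulLin b c 1 * (x 0 * z 1 + x 1 * z 0)
      + mulLin b c 2 * (x 0 * z 2 + x 2 * z 0) + 2 * mulLin b c 3 * x 1 * z 1
      + mulLin b c 4 * (x 1 * z 2 + x 2 * z 1) + 2 * mulLin b c 5 * x 2 * z 2 := by
  simp [dotL_apply, mulLin]; ring

lemma mulLin_eval' {F : Type} [Field F] (b c : Fin 3 → F) (x : Fin 3 → F) :
    dotL b x * dotL c x =
      mulLin b c 0 * x 0 * x 0 + mulLin b c 1 * (x 0 * x 1)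
      + mulLin b c 2 * (x 0 * x 2) + mulLin b c 3 * x 1 * x 1
      + mulLin b c 4 * (x 1 * x 2) + mulLin b c 5 * x 2 * x 2 := by
  simp [dotL_apply, mulLin]; ring

lemma fact_unique {F : Type} [Field F] (l1 l2 m1 m2 : Fin 3 → F) (h1 : l1 ≠ 0) (h2 : l2 ≠ 0)
    (h : mulLin m1 m2 = mulLin l1 l2) :
    ∃ u : F, u ≠ 0 ∧ ((m1 = u • l1 ∧ m2 = u⁻¹ • l2) ∨ (m1 = u • l2 ∧ m2 = u⁻¹ • l1)) := by
  have aux : ∀ m1 m2 : Fin 3 → F, mulLin m1 m2 = mulLin l1 l2 → (∃ u : F, m1 = u • l1) →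
      ∃ u : F, u ≠ 0 ∧ (m1 = u • l1 ∧ m2 = u⁻¹ • l2) := by
    rintro m1 m2 h ⟨u, rfl⟩
    rw [mulLin_smul, ← mulLin_smul_right, ← sub_eq_zero, ← mulLin_sub] at h
    have := sub_eq_zero.mp (mulLin_eq_zero _ _ h1 h)
    have hu : u ≠ 0 := by
      rintro rfl
      exact h2 (by rw [← this]; simp)
    exact ⟨u, hu, rfl, by rw [← this, smul_smul, inv_mul_cancel₀ hu, one_smul]⟩
  have hor : (∃ u : F, m1 = u • l1) ∨ (∃ u : F, m2 = u • l1) := by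
    by_contra hcon
    rw [not_or] at hcon
    have g1 : ∃ x, dotL l1 x = 0 ∧ dotL m1 x ≠ 0 := by
      by_contra hh
      push Not at hh
      exact hcon.1 (prop_of_ker _ _ h1 hh)
    have g2 : ∃ x, dotL l1 x = 0 ∧ dotL m2 x ≠ 0 := by
      by_contra hh
      push Not at hh
      exact hcon.2 (prop_of_ker _ _ h1 hh)
    obtain ⟨x, hx, hx'⟩ := g1
    obtain ⟨z, hz, hz'⟩ := g2
    have ex : dotL m1 x * dotL m2 x = 0 := by
      rw [mulLin_eval', h, ← mulLin_eval', hx, zero_mul]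
    have ez : dotL m1 z * dotL m2 z = 0 := by
      rw [mulLin_eval', h, ← mulLin_eval', hz, zero_mul]
    have exz : dotL m1 x * dotL m2 z + dotL m1 z * dotL m2 x = 0 := by
      rw [mulLin_eval, h, ← mulLin_eval, hx, hz, zero_mul, zero_mul, add_zero]
    have a1 : dotL m2 x = 0 := (mul_eq_zero.mp ex).resolve_left hx'
    rw [a1, mul_zero, add_zero] at exz
    exact (mul_ne_zero hx' hz') exz
  rcases hor with hu | hu
  · obtain ⟨u, hu, a, b⟩ := aux m1 m2 h hu
    exact ⟨u, hu, Or.inl ⟨a, b⟩⟩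
  · obtain ⟨u, hu, a, b⟩ := aux m2 m1 (by rw [mulLin_comm, h]) hu
    exact ⟨u⁻¹, inv_ne_zero hu, Or.inr ⟨b, by rw [inv_inv]; exact a⟩⟩

lemma Bform_mulLin {F : Type} [Field F] (y : Fin 6 → F) (b c : Fin 3 → F) :
    Bform (mulLin b c) y = dotL (M y *ᵥ b) c := by
  simp [Bform, mulLin, dotL_apply, M, dotProduct, Fin.sum_univ_three]; ring

lemma card_ker {F : Type} [Field F] [Fintype F] (y : Fin 6 → F) (hrk : (M y).rank = 2) :
    (Finset.univ.filter fun b => M y *ᵥ b = 0).card = Fintype.card F := by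
  have h1 := LinearMap.finrank_range_add_finrank_ker (M y).mulVecLin
  change (M y).rank + _ = _ at h1
  rw [hrk] at h1
  simp only [Module.finrank_fintype_fun_eq_card, Fintype.card_fin] at h1
  have h2 : Module.finrank F (LinearMap.ker (M y).mulVecLin) = 1 := by omega
  have h3 := Module.card_eq_pow_finrank (K := F) (V := LinearMap.ker (M y).mulVecLin)
  rw [h2, pow_one] at h3
  rw [← h3, Fintype.card_subtype]
  simp

lemma det_zero {F : Type} [Field F] (y : Fin 6 → F) (hrk : (M y).rank = 2) :
    (M y).det = 0 := by
  by_contra hd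
  have := Matrix.rank_of_isUnit (M y) ((Matrix.isUnit_iff_isUnit_det _).mpr (IsUnit.mk0 _ hd))
  rw [hrk] at this
  simp at this

lemma card_isotropic {F : Type} [Field F] [Fintype F] (h : Even (Fintype.card F)) (y : Fin 6 → F)
    (hns : ¬ (y 0 = 0 ∧ y 3 = 0 ∧ y 5 = 0)) :
    (Finset.univ.filter fun b : Fin 3 → F => Bform (mulLin b b) y = 0).card
      = Fintype.card F ^ 2 := by
  have hc : CharP F 2 := char_two h
  have h2 : (2 : F) = 0 := CharTwo.two_eq_zero
  obtain ⟨r0, hr0⟩ := ex_sqrt h (y 0)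
  obtain ⟨r3, hr3⟩ := ex_sqrt h (y 3)
  obtain ⟨r5, hr5⟩ := ex_sqrt h (y 5)
  have hw : (![r0, r3, r5] : Fin 3 → F) ≠ 0 := by
    intro hw
    have z0 : r0 = 0 := congrFun hw 0
    have z1 : r3 = 0 := congrFun hw 1
    have z2 : r5 = 0 := congrFun hw 2
    exact hns ⟨by simp [hr0, z0], by simp [hr3, z1], by simp [hr5, z2]⟩
  rw [← card_dot _ hw 0]
  congr 1
  ext b
  simp only [Finset.mem_filter, Finset.mem_univ, true_and]
  have : Bform (mulLin b b) y = (dotL ![r0, r3, r5] b) ^ 2 := by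
    simp [Bform, mulLin, dotL_apply, hr0, hr3, hr5]
    linear_combination (b 0 * b 1 * y 1 + b 0 * b 2 * y 2 + b 1 * b 2 * y 4
      - r0 * b 0 * r3 * b 1 - r0 * b 0 * r5 * b 2 - r3 * b 1 * r5 * b 2) * h2
  rw [this]
  exact pow_eq_zero_iff two_ne_zero

lemma card_indep {F : Type} [Field F] [Fintype F] (h : Even (Fintype.card F)) (y : Fin 6 → F)
    (hrk : (M y).rank = 2) (hns : ¬ (y 0 = 0 ∧ y 3 = 0 ∧ y 5 = 0)) :
    (Finset.univ.filter fun p : (Fin 3 → F) × (Fin 3 → F) =>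
      p.1 ≠ 0 ∧ (¬ ∃ t : F, p.2 = t • p.1) ∧ Bform (mulLin p.1 p.2) y = 0).card
      + (Fintype.card F ^ 2 * Fintype.card F + (Fintype.card F ^ 3 - Fintype.card F ^ 2) * 1)
      + (Fintype.card F ^ 3 - Fintype.card F)
      = Fintype.card F * Fintype.card F ^ 3
        + (Fintype.card F ^ 3 - Fintype.card F) * Fintype.card F ^ 2 := by
  have hq : 0 < Fintype.card F := Fintype.card_pos
  have hle : Fintype.card F ≤ Fintype.card F ^ 3 := Nat.le_self_pow (by norm_num) _
  rw [card_pair]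
  have s1 := sum_ite_card (fun b : Fin 3 → F => M y *ᵥ b = 0) (Fintype.card F ^ 3)
    (Fintype.card F ^ 2)
  have s2 := sum_ite_card (fun b : Fin 3 → F => Bform (mulLin b b) y = 0) (Fintype.card F) 1
  have s3 := sum_ite_card (fun b : Fin 3 → F => b = 0) (Fintype.card F ^ 3 - Fintype.card F) 0
  rw [card_ker y hrk, Fintype.card_fun, Fintype.card_fin] at s1
  rw [card_isotropic h y hns, Fintype.card_fun, Fintype.card_fin] at s2
  have c1 : (Finset.univ.filter fun b : Fin 3 → F => b = 0).card = 1 := by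
    rw [Finset.card_eq_one]; exact ⟨0, by ext; simp⟩
  rw [c1, one_mul, mul_zero, add_zero] at s3
  rw [← s1, ← s2]
  conv_lhs => rw [← s3]
  rw [← Finset.sum_add_distrib, ← Finset.sum_add_distrib]
  refine Finset.sum_congr rfl fun b _ => ?_
  by_cases hb : b = 0
  · subst hb
    have z : Bform (mulLin (0 : Fin 3 → F) 0) y = 0 := by simp [Bform, mulLin]
    simp [z]
    omega
  · have g : (Finset.univ.filter fun c => Bform (mulLin b c) y = 0).card
        = if M y *ᵥ b = 0 then Fintype.card F ^ 3 else Fintype.card F ^ 2 := by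
      simp only [Bform_mulLin]
      split_ifs with hm
      · rw [hm]
        have : ∀ c, dotL (0 : Fin 3 → F) c = 0 := by intro c; simp [dotL_apply]
        simp [this]
      · exact card_dot _ hm 0
    rw [← g, if_neg hb, add_zero]
    have hh : (Finset.univ.filter fun c => Bform (mulLin b c) y = 0 ∧ ∃ t : F, c = t • b).card
        = if Bform (mulLin b b) y = 0 then Fintype.card F else 1 := by
      have hsc : ∀ t : F, Bform (mulLin b (t • b)) y = t * Bform (mulLin b b) y := by
        intro t; rw [Bform_mulLin, Bform_mulLin, map_smul, smul_eq_mul]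
      have e : (Finset.univ.filter fun c => Bform (mulLin b c) y = 0 ∧ ∃ t : F, c = t • b)
        = (Finset.univ.filter fun t : F => t * Bform (mulLin b b) y = 0).image
            fun t => t • b := by
        ext c
        simp only [Finset.mem_filter, Finset.mem_univ, true_and, Finset.mem_image]
        constructor
        · rintro ⟨h1, t, rfl⟩; exact ⟨t, by rw [← hsc, h1], rfl⟩
        · rintro ⟨t, h1, rfl⟩; exact ⟨by rw [hsc, h1], t, rfl⟩
      rw [e, Finset.card_image_of_injective _ (smul_left_injective F hb)]
      split_ifs with hi
      · simp [hi]
      · rw [Finset.card_eq_one]; exact ⟨0, by ext; simp [hi]⟩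
    rw [← hh, ← Finset.card_filter_add_card_filter_not (s := Finset.univ.filter
      fun c => Bform (mulLin b c) y = 0) (fun c => ∃ t : F, c = t • b), Finset.filter_filter,
      Finset.filter_filter, add_comm]
    congr 2
    ext c
    simp [hb, and_comm]

lemma realPair_iff {F : Type} [Field F] (a : Fin 6 → F) :
    IsRealPair a ↔ ∃ l1 l2 : Fin 3 → F, l1 ≠ 0 ∧ (¬ ∃ t : F, l2 = t • l1) ∧ a = mulLin l1 l2 := by
  constructor
  · rintro ⟨l1, l2, h1, h2, h3⟩
    refine ⟨l1, l2, ?_, h1, h3⟩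
    rintro rfl
    exact h2 ⟨0, by simp⟩
  · rintro ⟨l1, l2, h1, h2, h3⟩
    refine ⟨l1, l2, h2, ?_, h3⟩
    rintro ⟨t, ht⟩
    have h0 : t ≠ 0 := by
      rintro rfl
      exact h1 (by rw [ht]; simp)
    exact h2 ⟨t⁻¹, by rw [ht, smul_smul, inv_mul_cancel₀ h0, one_smul]⟩

lemma card_real {F : Type} [Field F] [Fintype F] (y : Fin 6 → F) :
    (Finset.univ.filter fun p : (Fin 3 → F) × (Fin 3 → F) =>
      p.1 ≠ 0 ∧ (¬ ∃ t : F, p.2 = t • p.1) ∧ Bform (mulLin p.1 p.2) y = 0).card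
    = (Finset.univ.filter fun a : Fin 6 → F => a ≠ 0 ∧ a ∈ squab y ∧ IsRealPair a).card
      * (2 * (Fintype.card F - 1)) := by
  set S := Finset.univ.filter fun p : (Fin 3 → F) × (Fin 3 → F) =>
      p.1 ≠ 0 ∧ (¬ ∃ t : F, p.2 = t • p.1) ∧ Bform (mulLin p.1 p.2) y = 0 with hS
  have memS : ∀ p, p ∈ S ↔ p.1 ≠ 0 ∧ (¬ ∃ t : F, p.2 = t • p.1) ∧ Bform (mulLin p.1 p.2) y = 0 := by
    intro p; simp [hS]
  have ne2 : ∀ l1 l2 : Fin 3 → F, (¬ ∃ t : F, l2 = t • l1) → l2 ≠ 0 := by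
    rintro l1 l2 h rfl; exact h ⟨0, by simp⟩
  have himg : (Finset.univ.filter fun a : Fin 6 → F => a ≠ 0 ∧ a ∈ squab y ∧ IsRealPair a)
      = S.image fun p => mulLin p.1 p.2 := by
    ext a
    simp only [Finset.mem_filter, Finset.mem_univ, true_and, Finset.mem_image, realPair_iff, memS]
    constructor
    · rintro ⟨-, hW, l1, l2, h1, h2, rfl⟩
      exact ⟨(l1, l2), ⟨h1, h2, hW⟩, rfl⟩
    · rintro ⟨⟨l1, l2⟩, ⟨h1, h2, hW⟩, rfl⟩
      exact ⟨fun h => ne2 _ _ h2 (mulLin_eq_zero _ _ h1 h), hW, l1, l2, h1, h2, rfl⟩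
  rw [himg, Finset.card_eq_sum_card_image (fun p : (Fin 3 → F) × (Fin 3 → F) => mulLin p.1 p.2) S]
  refine Finset.sum_const_nat ?_
  intro a ha
  obtain ⟨⟨l1, l2⟩, hp, rfl⟩ := Finset.mem_image.mp ha
  obtain ⟨h1, h2, hW⟩ := (memS _).mp hp
  simp only at h1 h2 hW
  have h2' := ne2 _ _ h2
  have h3 : ¬ ∃ t : F, l1 = t • l2 := by
    rintro ⟨t, ht⟩
    have h0 : t ≠ 0 := by
      rintro rfl
      exact h1 (by rw [ht]; simp)
    exact h2 ⟨t⁻¹, by rw [ht, smul_smul, inv_mul_cancel₀ h0, one_smul]⟩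
  have scal : ∀ (l m : Fin 3 → F) (u : F), u ≠ 0 → (¬ ∃ t : F, m = t • l) →
      ¬ ∃ t : F, u⁻¹ • m = t • (u • l) := by
    rintro l m u hu h ⟨t, ht⟩
    refine h ⟨u * (t * u), ?_⟩
    rw [mul_smul, mul_smul, ← ht, smul_smul, mul_inv_cancel₀ hu, one_smul]
  have prodeq : ∀ (l m : Fin 3 → F) (u : F), u ≠ 0 → mulLin (u • l) (u⁻¹ • m) = mulLin l m := by
    intro l m u hu
    rw [mulLin_smul, mulLin_smul_right, smul_smul, mul_inv_cancel₀ hu, one_smul]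
  have fib : (S.filter fun p => mulLin p.1 p.2 = mulLin l1 l2)
      = ((Finset.univ.erase (0 : F)).image fun u => (u • l1, u⁻¹ • l2))
        ∪ ((Finset.univ.erase (0 : F)).image fun u => (u • l2, u⁻¹ • l1)) := by
    ext ⟨m1, m2⟩
    simp only [Finset.mem_filter, memS, Finset.mem_union, Finset.mem_image, Finset.mem_erase,
      Finset.mem_univ, and_true, Prod.mk.injEq]
    constructor
    · rintro ⟨-, he⟩
      obtain ⟨u, hu, ⟨a, b⟩ | ⟨a, b⟩⟩ := fact_unique _ _ _ _ h1 h2' he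
      · exact Or.inl ⟨u, hu, a.symm, b.symm⟩
      · exact Or.inr ⟨u, hu, a.symm, b.symm⟩
    · rintro (⟨u, hu, rfl, rfl⟩ | ⟨u, hu, rfl, rfl⟩)
      · rw [prodeq _ _ _ hu]
        exact ⟨⟨smul_ne_zero hu h1, scal _ _ _ hu h2, hW⟩, rfl⟩
      · rw [prodeq _ _ _ hu, mulLin_comm l2 l1]
        exact ⟨⟨smul_ne_zero hu h2', scal _ _ _ hu h3, hW⟩, rfl⟩
  simp only
  rw [fib, Finset.card_union_of_disjoint, Finset.card_image_of_injective,
    Finset.card_image_of_injective, Finset.card_erase_of_mem (Finset.mem_univ _), Finset.card_univ,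
    two_mul]
  · intro u v huv
    exact smul_left_injective F h2' (congrArg Prod.fst huv)
  · intro u v huv
    exact smul_left_injective F h1 (congrArg Prod.fst huv)
  · rw [Finset.disjoint_left]
    intro p hp1 hp2
    obtain ⟨u, hu, rfl⟩ := Finset.mem_image.mp hp1
    obtain ⟨v, hv, huv⟩ := Finset.mem_image.mp hp2
    have hv0 : v ≠ 0 := by simpa using hv
    have e : v • l2 = u • l1 := congrArg Prod.fst huv
    exact h2 ⟨v⁻¹ * u, by rw [mul_smul, ← e, smul_smul, inv_mul_cancel₀ hv0, one_smul]⟩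

lemma card_squab {F : Type} [Field F] [Fintype F] (y : Fin 6 → F)
    (hns : ¬ (y 0 = 0 ∧ y 3 = 0 ∧ y 5 = 0)) :
    (Finset.univ.filter fun a : Fin 6 → F => Bform a y = 0).card
      = Fintype.card F ^ 3 * Fintype.card F ^ 2 := by
  have hw : (![y 0, y 3, y 5] : Fin 3 → F) ≠ 0 := by
    intro hw
    exact hns ⟨congrFun hw 0, congrFun hw 1, congrFun hw 2⟩
  rw [card_spl]
  have key : ∀ n : Fin 3 → F,
      (Finset.univ.filter fun d => Bform (spl F (n, d)) y = 0).card = Fintype.card F ^ 2 := by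
    intro n
    rw [← card_dot _ hw (-(y 1 * n 2 + y 2 * n 1 + y 4 * n 0))]
    congr 1
    ext d
    simp only [Finset.mem_filter, Finset.mem_univ, true_and]
    have : Bform (spl F (n, d)) y = d 0 * y 0 + n 2 * y 1 + n 1 * y 2 + d 1 * y 3 + n 0 * y 4
      + d 2 * y 5 := rfl
    rw [this, eq_neg_iff_add_eq_zero]
    have e : dotL ![y 0, y 3, y 5] d = y 0 * d 0 + y 3 * d 1 + y 5 * d 2 := rfl
    rw [e]
    constructor <;> intro hh <;> linear_combination hh
  rw [Finset.sum_congr rfl (fun n _ => key n)]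
  simp

lemma disc_mulLin {F : Type} [Field F] (b c : Fin 3 → F) : disc (mulLin b c) = 0 := by
  simp [disc, mulLin]; ring

lemma disc_smul {F : Type} [Field F] (u : F) (a : Fin 6 → F) : disc (u • a) = u ^ 3 * disc a := by
  simp [disc]; ring

lemma not_double_of_real {F : Type} [Field F] [Fintype F] (h : Even (Fintype.card F))
    (a : Fin 6 → F) (ha : a ≠ 0) (hr : IsRealPair a) : ¬ IsDoubleLine a := by
  have hc : CharP F 2 := char_two h
  rw [double_iff h a ha]
  obtain ⟨l1, l2, h1, h2, rfl⟩ := (realPair_iff a).mp hr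
  rintro ⟨e1, e2, e4⟩
  have e1' : l1 0 * l2 1 + l1 1 * l2 0 = 0 := e1
  have e2' : l1 0 * l2 2 + l1 2 * l2 0 = 0 := e2
  have e4' : l1 1 * l2 2 + l1 2 * l2 1 = 0 := e4
  rw [CharTwo.add_eq_zero] at e1' e2' e4'
  obtain ⟨k, hk⟩ := Function.ne_iff.mp h1
  simp only [Pi.zero_apply] at hk
  apply h2
  refine ⟨l2 k / l1 k, ?_⟩
  ext i
  simp only [Pi.smul_apply, smul_eq_mul]
  field_simp
  fin_cases k <;> fin_cases i <;> simp <;>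
    first
    | ring1
    | linear_combination e1'
    | linear_combination - e1'
    | linear_combination e2'
    | linear_combination - e2'
    | linear_combination e4'
    | linear_combination - e4'

lemma prod_cases {F : Type} [Field F] (a : Fin 6 → F) (ha : a ≠ 0) :
    (∃ l1 l2 : Fin 3 → F, a = mulLin l1 l2) → IsDoubleLine a ∨ IsRealPair a := by
  rintro ⟨l1, l2, rfl⟩
  have h1 : l1 ≠ 0 := by
    rintro rfl
    apply ha
    ext i; fin_cases i <;> simp [mulLin]
  by_cases h2 : ∃ t : F, l2 = t • l1
  · obtain ⟨t, rfl⟩ := h2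
    left
    rw [mulLin_smul_right] at ha ⊢
    refine ⟨t, l1, ?_, h1, rfl⟩
    rintro rfl
    exact ha (by simp)
  · right
    exact (realPair_iff _).mpr ⟨l1, l2, h1, h2, rfl⟩

lemma prod_of_double {F : Type} [Field F] (a : Fin 6 → F) (h : IsDoubleLine a) :
    ∃ l1 l2 : Fin 3 → F, a = mulLin l1 l2 := by
  obtain ⟨c, l, -, -, rfl⟩ := h
  exact ⟨c • l, l, by rw [mulLin_smul]⟩

lemma prod_of_real {F : Type} [Field F] (a : Fin 6 → F) (h : IsRealPair a) :
    ∃ l1 l2 : Fin 3 → F, a = mulLin l1 l2 := by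
  obtain ⟨l1, l2, -, -, rfl⟩ := h
  exact ⟨l1, l2, rfl⟩

lemma card_sing_split {F : Type} [Field F] [Fintype F] (h : Even (Fintype.card F))
    (y : Fin 6 → F) :
    (Finset.univ.filter fun a : Fin 6 → F => Bform a y = 0 ∧ disc a = 0).card
    = 1 + (Finset.univ.filter fun a : Fin 6 → F => a ≠ 0 ∧ a ∈ squab y ∧ IsDoubleLine a).card
      + (Finset.univ.filter fun a : Fin 6 → F => a ≠ 0 ∧ a ∈ squab y ∧ IsRealPair a).card
      + (Finset.univ.filter fun a : Fin 6 → F => a ≠ 0 ∧ a ∈ squab y ∧ IsImagPair a).card := by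
  have c1 : (Finset.univ.filter fun a : Fin 6 → F => a = 0).card = 1 := by
    rw [Finset.card_eq_one]; exact ⟨0, by ext; simp⟩
  rw [← c1]
  simp only [Finset.card_filter]
  rw [← Finset.sum_add_distrib, ← Finset.sum_add_distrib, ← Finset.sum_add_distrib]
  refine Finset.sum_congr rfl fun a _ => ?_
  have hm : a ∈ squab y ↔ Bform a y = 0 := Iff.rfl
  by_cases ha : a = 0
  · subst ha
    simp [Bform, disc]
  by_cases hW : Bform a y = 0
  swap
  · simp [ha, hm, hW]
  simp only [ha, hm, hW, if_false, true_and, not_false_eq_true, ne_eq, zero_add]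
  by_cases hP : ∃ l1 l2 : Fin 3 → F, a = mulLin l1 l2
  · have hd : disc a = 0 := by
      obtain ⟨l1, l2, rfl⟩ := hP
      exact disc_mulLin _ _
    have hi : ¬ IsImagPair a := fun hi => hi.2 hP
    by_cases hR : IsRealPair a
    · have := not_double_of_real h a ha hR
      simp [hd, hi, hR, this]
    · have := (prod_cases a ha hP).resolve_right hR
      simp [hd, hi, hR, this]
  · have hD : ¬ IsDoubleLine a := fun hh => hP (prod_of_double a hh)
    have hR : ¬ IsRealPair a := fun hh => hP (prod_of_real a hh)
    have hI : IsImagPair a ↔ disc a = 0 := ⟨fun hh => hh.1, fun hh => ⟨hh, hP⟩⟩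
    simp [hD, hR, hI]

lemma card_squab_split {F : Type} [Field F] [Fintype F] (y : Fin 6 → F) :
    (Finset.univ.filter fun a : Fin 6 → F => Bform a y = 0).card
    = (Finset.univ.filter fun a : Fin 6 → F => Bform a y = 0 ∧ disc a = 0).card
      + (Finset.univ.filter fun a : Fin 6 → F =>
          a ≠ 0 ∧ a ∈ squab y ∧ IsNonsingular a).card := by
  rw [← Finset.card_filter_add_card_filter_not (s := Finset.univ.filter
      fun a => Bform a y = 0) (fun a => disc a = 0), Finset.filter_filter, Finset.filter_filter]
  congr 2
  ext a
  have hm : a ∈ squab y ↔ Bform a y = 0 := Iff.rfl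
  simp only [Finset.mem_filter, Finset.mem_univ, true_and, hm]
  constructor
  · rintro ⟨h1, h2⟩
    refine ⟨?_, h1, h2⟩
    rintro rfl
    exact h2 (by simp [disc])
  · rintro ⟨-, h1, h2⟩; exact ⟨h1, h2⟩

lemma arith (m D R I N : ℕ) (hm : 0 < m) (hD : D * m = (m + 2) * m)
    (hR1 : R * m * (2 * m) + ((m + 1) ^ 2 * (m + 1) + (m + 1) ^ 2 * m * 1)
      + (m + 1) * (m + 2) * m
      = (m + 1) * (m + 1) ^ 3 + (m + 1) * (m + 2) * m * (m + 1) ^ 2)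
    (hS : 1 + D * m + R * m + I * m
      = (m + 1) * (m + 1) ^ 2 + (m + 1) * (m + 2) * m * (m + 1))
    (hTS : (m + 1) ^ 3 * (m + 1) ^ 2
      = (m + 1) * (m + 1) ^ 2 + (m + 1) * (m + 2) * m * (m + 1) + N * m) :
    D = m + 1 + 1 ∧ 2 * R = (m + 1) ^ 3 + 3 * (m + 1) ^ 2 + (m + 1)
    ∧ 2 * I + (m + 1) = (m + 1) ^ 3 + (m + 1) ^ 2 ∧ N = (m + 1) ^ 2 * (m + 2) * m := by
  have eD : D = m + 1 + 1 := Nat.eq_of_mul_eq_mul_right hm hD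
  subst eD
  zify at *
  have hm0 : (m : ℤ) ≠ 0 := by omega
  have eR : 2 * (R : ℤ) = (m + 1) ^ 3 + 3 * (m + 1) ^ 2 + (m + 1) := by
    apply mul_right_cancel₀ (mul_ne_zero hm0 hm0)
    linear_combination hR1
  refine ⟨trivial, eR, ?_, ?_⟩
  · apply mul_right_cancel₀ hm0
    linear_combination 2 * hS - m * eR
  · apply mul_right_cancel₀ hm0
    linear_combination - hTS

end aux

/-- conic counts of the squab of a rank-2 point off the nucleus plane, `q` even. -/
theorem squab_rank_two_off_nucleus_conic_counts (F : Type) [Field F] [Fintype F] (q : ℕ)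
    (hq : Fintype.card F = q) (heven : Even q) (y : Fin 6 → F) (hy : y ≠ 0)
    (hrk : (M y).rank = 2) (hns : ¬ (y 0 = 0 ∧ y 3 = 0 ∧ y 5 = 0)) :
    numConics (squab y) IsDoubleLine = q + 1 ∧
    numConics (squab y) IsRealPair = (q ^ 3 + 3 * q ^ 2 + q) / 2 ∧
    numConics (squab y) IsImagPair = (q ^ 3 + q ^ 2 - q) / 2 ∧
    numConics (squab y) IsNonsingular = q ^ 4 - q ^ 2 := by
  classical
  subst hq
  have hdet := det_zero y hrk
  have hD := card_double heven y hns
  have hR1 := card_indep heven y hrk hns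
  have hR2 := card_real y
  have hS := card_sing heven y hdet hns
  have hSS := card_sing_split heven y
  have hT := card_squab y hns
  have hTS := card_squab_split y
  have kIsDoubleLine := numConics_mul (squab y) IsDoubleLine (by
    rintro u a hu ⟨c, l, h1, h2, rfl⟩
    exact ⟨u * c, l, mul_ne_zero hu h1, h2, by rw [mul_smul]⟩)
  rw [kIsDoubleLine] at hD hSS
  have kIsRealPair := numConics_mul (squab y) IsRealPair (by
    intro u a hu ha
    obtain ⟨l1, l2, h1, h2, rfl⟩ := (realPair_iff a).mp ha
    refine (realPair_iff _).mpr ⟨l1, u • l2, h1, ?_, by rw [mulLin_smul_right]⟩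
    rintro ⟨t, ht⟩
    exact h2 ⟨u⁻¹ * t, by rw [mul_smul, ← ht, smul_smul, inv_mul_cancel₀ hu, one_smul]⟩)
  rw [kIsRealPair] at hR2 hSS
  have kIsImagPair := numConics_mul (squab y) IsImagPair (by
    rintro u a hu ⟨h1, h2⟩
    refine ⟨by rw [disc_smul, h1, mul_zero], ?_⟩
    rintro ⟨l1, l2, hl⟩
    exact h2 ⟨u⁻¹ • l1, l2, by rw [mulLin_smul, ← hl, smul_smul, inv_mul_cancel₀ hu, one_smul]⟩)
  rw [kIsImagPair] at hSS
  have kIsNonsingular := numConics_mul (squab y) IsNonsingular (by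
    intro u a hu h1
    unfold IsNonsingular at *
    rw [disc_smul]
    exact mul_ne_zero (pow_ne_zero _ hu) h1)
  rw [kIsNonsingular] at hTS
  rw [hR2] at hR1
  rw [hSS] at hS
  rw [hT, hSS] at hTS
  clear hR2 hSS hT
  generalize numConics (squab y) IsDoubleLine = D at *
  generalize numConics (squab y) IsRealPair = R at *
  generalize numConics (squab y) IsImagPair = I at *
  generalize numConics (squab y) IsNonsingular = N at *
  have hq1 : 1 < Fintype.card F := Fintype.one_lt_card
  generalize Fintype.card F = q at *
  obtain ⟨m, rfl⟩ : ∃ m, q = m + 1 := ⟨q - 1, by omega⟩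
  have hm : 0 < m := by omega
  simp only [Nat.add_sub_cancel] at *
  have a1 : (m + 1) ^ 2 - 1 = (m + 2) * m := by
    rw [Nat.sub_eq_iff_eq_add (Nat.one_le_pow _ _ (by omega))]; ring
  have a2 : (m + 1) ^ 3 - (m + 1) = (m + 1) * (m + 2) * m := by
    rw [Nat.sub_eq_iff_eq_add (Nat.le_self_pow (by norm_num) _)]; ring
  have a3 : (m + 1) ^ 3 - (m + 1) ^ 2 = (m + 1) ^ 2 * m := by
    rw [Nat.sub_eq_iff_eq_add (Nat.pow_le_pow_right (by omega) (by norm_num))]; ring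
  have a4 : (m + 1) ^ 4 - (m + 1) ^ 2 = (m + 1) ^ 2 * (m + 2) * m := by
    rw [Nat.sub_eq_iff_eq_add (Nat.pow_le_pow_right (by omega) (by norm_num))]; ring
  rw [a1] at hD
  rw [a2, a3] at hR1
  rw [a2] at hS
  rw [hS] at hTS
  obtain ⟨eD, eR, eI, eN⟩ := arith m D R I N hm hD hR1 hS hTS
  exact ⟨eD, by omega, by omega, by rw [a4, eN]⟩
end Conics
end

section
/- Let q be any prime power and F = GF(q), and let y ∈ F^6 be nonzero. If rank(M_y) ≤ 2 then the squab S_y contains exactly q^4−q^2 nonsingular conics, and if rank(M_y) = 3 then S_y contains exactly q^4 nonsingular conics. (In particular every point of the secant variety of the Veronese surface lies in exactly q^4−q^2 hyperplanes corresponding to nonsingular conics.) -/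
open Matrix

namespace Conics

section helpers

open Classical in
/-- The number of coefficient vectors in the squab with nonzero discriminant. -/
noncomputable def Nn {F : Type} [Field F] [Fintype F] (y : Fin 6 → F) : ℤ :=
  ∑ a : Fin 6 → F, if Bform a y = 0 ∧ disc a ≠ 0 then 1 else 0

/-- Explicit determinant of `M y`. -/
def dt {F : Type} [Field F] (y : Fin 6 → F) : F :=
  y 0 * (y 3 * y 5 - y 4 ^ 2) - y 1 * (y 1 * y 5 - y 4 * y 2) + y 2 * (y 1 * y 4 - y 3 * y 2)

open Classical in
/-- The claimed count. -/
def Good {F : Type} [Field F] [Fintype F] (y : Fin 6 → F) : Prop :=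
  Nn y = ((Fintype.card F : ℤ) - 1) * ((Fintype.card F : ℤ) ^ 4 -
    if dt y = 0 then (Fintype.card F : ℤ) ^ 2 else 0)

lemma good_of {F : Type} [Field F] [Fintype F] (y y' : Fin 6 → F)
    (φ ψ : (Fin 6 → F) → (Fin 6 → F)) (h1 : ∀ a, ψ (φ a) = a) (h2 : ∀ a, φ (ψ a) = a)
    (hd : ∀ a, disc (φ a) = disc a) (hB : ∀ a, Bform (φ a) y = Bform a y')
    (ht : dt y' = dt y) (h : Good y') : Good y := by
  classical
  unfold Good at *
  rw [← ht, ← h]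
  unfold Nn
  symm
  apply Fintype.sum_equiv (⟨φ, ψ, h1, h2⟩ : (Fin 6 → F) ≃ (Fin 6 → F))
  intro a
  simp [hd, hB]

lemma good_swap01 {F : Type} [Field F] [Fintype F] (y : Fin 6 → F)
    (h : Good ![y 3, y 1, y 4, y 0, y 2, y 5]) : Good y := by
  refine good_of y _ (fun a => ![a 3, a 1, a 4, a 0, a 2, a 5])
    (fun a => ![a 3, a 1, a 4, a 0, a 2, a 5]) ?_ ?_ ?_ ?_ ?_ h
  · intro a; ext i; fin_cases i <;> simp
  · intro a; ext i; fin_cases i <;> simp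
  · intro a; simp [disc]; ring
  · intro a; simp [Bform]; ring
  · simp [dt]; ring

lemma good_swap12 {F : Type} [Field F] [Fintype F] (y : Fin 6 → F)
    (h : Good ![y 0, y 2, y 1, y 5, y 4, y 3]) : Good y := by
  refine good_of y _ (fun a => ![a 0, a 2, a 1, a 5, a 4, a 3])
    (fun a => ![a 0, a 2, a 1, a 5, a 4, a 3]) ?_ ?_ ?_ ?_ ?_ h
  · intro a; ext i; fin_cases i <;> simp
  · intro a; ext i; fin_cases i <;> simp
  · intro a; simp [disc]; ring
  · intro a; simp [Bform]; ring
  · simp [dt]; ring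

/-- Substitution `X2 → X2 + s X0`. -/
lemma good_shear02 {F : Type} [Field F] [Fintype F] (s : F) (y : Fin 6 → F)
    (h : Good ![y 0, y 1, y 2 + s * y 0, y 3, y 4 + s * y 1,
      y 5 + 2 * s * y 2 + s ^ 2 * y 0]) : Good y := by
  refine good_of y _
    (fun a => ![a 0 + s * a 2 + s ^ 2 * a 5, a 1 + s * a 4, a 2 + 2 * s * a 5, a 3, a 4, a 5])
    (fun a => ![a 0 - s * a 2 + s ^ 2 * a 5, a 1 - s * a 4, a 2 - 2 * s * a 5, a 3, a 4, a 5])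
    ?_ ?_ ?_ ?_ ?_ h
  · intro a; ext i; fin_cases i <;> simp; ring
  · intro a; ext i; fin_cases i <;> simp; ring
  · intro a; simp [disc]; ring
  · intro a; simp [Bform]; ring
  · simp [dt]; ring

/-- Substitution `X2 → X2 + s X1`. -/
lemma good_shear12 {F : Type} [Field F] [Fintype F] (s : F) (y : Fin 6 → F)
    (h : Good ![y 0, y 1, y 2 + s * y 1, y 3, y 4 + s * y 3,
      y 5 + 2 * s * y 4 + s ^ 2 * y 3]) : Good y := by
  refine good_of y _
    (fun a => ![a 0, a 1 + s * a 2, a 2, a 3 + s * a 4 + s ^ 2 * a 5, a 4 + 2 * s * a 5, a 5])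
    (fun a => ![a 0, a 1 - s * a 2, a 2, a 3 - s * a 4 + s ^ 2 * a 5, a 4 - 2 * s * a 5, a 5])
    ?_ ?_ ?_ ?_ ?_ h
  · intro a; ext i; fin_cases i <;> simp; ring
  · intro a; ext i; fin_cases i <;> simp; ring
  · intro a; simp [disc]; ring
  · intro a; simp [Bform]; ring
  · simp [dt]; ring

/-- Substitution `X0 → X0 + t X1 + s X2`. -/
lemma good_shear0 {F : Type} [Field F] [Fintype F] (t s : F) (y : Fin 6 → F)
    (h : Good ![y 0 + 2 * t * y 1 + 2 * s * y 2 + t ^ 2 * y 3 + 2 * t * s * y 4 + s ^ 2 * y 5,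
      y 1 + t * y 3 + s * y 4, y 2 + t * y 4 + s * y 5, y 3, y 4, y 5]) : Good y := by
  refine good_of y _
    (fun a => ![a 0, a 1 + 2 * t * a 0, a 2 + 2 * s * a 0, a 3 + t * a 1 + t ^ 2 * a 0,
      a 4 + t * a 2 + s * a 1 + 2 * t * s * a 0, a 5 + s * a 2 + s ^ 2 * a 0])
    (fun a => ![a 0, a 1 - 2 * t * a 0, a 2 - 2 * s * a 0, a 3 - t * a 1 + t ^ 2 * a 0,
      a 4 - t * a 2 - s * a 1 + 2 * t * s * a 0, a 5 - s * a 2 + s ^ 2 * a 0])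
    ?_ ?_ ?_ ?_ ?_ h
  · intro a; ext i; fin_cases i <;> simp <;> ring
  · intro a; ext i; fin_cases i <;> simp <;> ring
  · intro a; simp [disc]; ring
  · intro a; simp [Bform]; ring
  · simp [dt]; ring

open Classical in
lemma sum_eq_const {F : Type} [Field F] [Fintype F] (c : F) (v : ℤ) :
    (∑ x : F, if x = c then v else 0) = v := by simp

open Classical in
lemma sum_ne_const {F : Type} [Field F] [Fintype F] (c : F) :
    (∑ x : F, if x ≠ c then (1 : ℤ) else 0) = (Fintype.card F : ℤ) - 1 := by
  have h : ∀ x : F, (if x ≠ c then (1 : ℤ) else 0) = 1 - if x = c then 1 else 0 := by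
    intro x; by_cases h : x = c <;> simp [h]
  simp [h, Finset.sum_sub_distrib]

/-- Key fact on degenerate binary forms. -/
lemma exists_unique_root {F : Type} [Field F] [Fintype F] (b c d x : F) (hb : b ≠ 0)
    (hD : 4 * b * d - c ^ 2 = 0) :
    ∃ z0 : F, ∀ z : F, x * z * c - b * z ^ 2 - d * x ^ 2 = 0 ↔ z = z0 := by
  by_cases h2 : (2 : F) = 0
  · have hc : c = 0 := by
      have : c ^ 2 = 0 := by linear_combination -hD + 2 * b * d * h2
      simpa using this
    subst hc
    have hch : ringChar F = 2 := by
      have : ((2 : ℕ) : F) = 0 := by exact_mod_cast h2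
      rw [ringChar.spec] at this
      rcases (Nat.dvd_prime Nat.prime_two).1 this with h | h
      · exact absurd h (CharP.ringChar_ne_one)
      · exact h
    obtain ⟨r, hr⟩ := FiniteField.isSquare_of_char_two hch (d * x ^ 2 / b)
    refine ⟨r, fun z => ?_⟩
    have hr' : b * r ^ 2 = d * x ^ 2 := by
      field_simp at hr
      linear_combination -hr
    constructor
    · intro h
      have h3 : b * (z - r) ^ 2 = 0 := by
        linear_combination -h + hr' - b * z * r * h2
      have : (z - r) ^ 2 = 0 := by simpa [hb] using h3
      exact sub_eq_zero.1 (by simpa using this)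
    · rintro rfl
      linear_combination -hr' - d * x ^ 2 * h2
  · refine ⟨c * x / (2 * b), fun z => ?_⟩
    have e : (2 * b * z - c * x) ^ 2 = -4 * b * (x * z * c - b * z ^ 2 - d * x ^ 2) := by
      linear_combination -x ^ 2 * hD
    constructor
    · intro h
      rw [h, mul_zero] at e
      have : 2 * b * z - c * x = 0 := by simpa using e
      field_simp
      linear_combination this
    · rintro rfl
      have h4 : (4 : F) ≠ 0 := by
        have : (4 : F) = 2 * 2 := by norm_num
        rw [this]; exact mul_ne_zero h2 h2
      have z0 : 2 * b * (c * x / (2 * b)) - c * x = 0 := by field_simp; ring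
      rw [z0] at e
      have e' : (4 * b) * (x * (c * x / (2 * b)) * c - b * (c * x / (2 * b)) ^ 2 - d * x ^ 2) = 0 := by
        linear_combination e
      exact (mul_eq_zero.1 e').resolve_left (mul_ne_zero h4 hb)

/-- Explicit discriminant. -/
def dd {F : Type} [Field F] (a0 a1 a2 a3 a4 a5 : F) : F :=
  4 * a0 * a3 * a5 + a1 * a2 * a4 - a0 * a4 ^ 2 - a3 * a2 ^ 2 - a5 * a1 ^ 2

open Classical in
lemma sum_pair {F : Type} [Field F] [Fintype F] (x a3 a4 a5 : F) (h : ¬ (a3 = 0 ∧ a4 = 0)) :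
    (∑ a2 : F, ∑ a0 : F, if dd a0 x a2 a3 a4 a5 ≠ 0 then (1 : ℤ) else 0) =
      (Fintype.card F : ℤ) * ((Fintype.card F : ℤ) - 1) := by
  by_cases hD : 4 * a3 * a5 - a4 ^ 2 = 0
  · have h3 : a3 ≠ 0 := by
      rintro rfl
      apply h
      refine ⟨rfl, ?_⟩
      have : a4 ^ 2 = 0 := by linear_combination -hD
      simpa using this
    obtain ⟨z0, hz⟩ := exists_unique_root a3 a4 a5 x h3 hD
    have : ∀ a0 a2 : F, dd a0 x a2 a3 a4 a5 ≠ 0 ↔ a2 ≠ z0 := by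
      intro a0 a2
      rw [not_iff_not, ← hz a2]
      have : dd a0 x a2 a3 a4 a5 = x * a2 * a4 - a3 * a2 ^ 2 - a5 * x ^ 2 := by
        unfold dd; linear_combination a0 * hD
      rw [this]
    simp_rw [this]
    rw [Finset.sum_comm]
    simp only [sum_ne_const]
    simp
    ring
  · have : ∀ a0 a2 : F, dd a0 x a2 a3 a4 a5 ≠ 0 ↔
        a0 ≠ -(x * a2 * a4 - a3 * a2 ^ 2 - a5 * x ^ 2) / (4 * a3 * a5 - a4 ^ 2) := by
      intro a0 a2
      rw [not_iff_not, eq_div_iff hD]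
      unfold dd
      constructor <;> intro h <;> linear_combination h
    simp_rw [this, sum_ne_const]
    simp
    ring

open Classical in
lemma sum_pair0 {F : Type} [Field F] [Fintype F] (x a5 : F) :
    (∑ a2 : F, ∑ a0 : F, if dd a0 x a2 0 0 a5 ≠ 0 then (1 : ℤ) else 0) =
      if a5 ≠ 0 ∧ x ≠ 0 then (Fintype.card F : ℤ) ^ 2 else 0 := by
  have : ∀ a0 a2 : F, dd a0 x a2 0 0 a5 ≠ 0 ↔ a5 ≠ 0 ∧ x ≠ 0 := by
    intro a0 a2
    have : dd a0 x a2 0 0 a5 = -(a5 * x ^ 2) := by unfold dd; ring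
    rw [this]
    simp
  simp_rw [this]
  split_ifs <;> simp [sq]

/-- Coordinates. -/
def coords (F : Type) : (Fin 6 → F) ≃ F × F × F × F × F × F where
  toFun a := (a 3, a 4, a 5, a 1, a 2, a 0)
  invFun p := ![p.2.2.2.2.2, p.2.2.2.1, p.2.2.2.2.1, p.1, p.2.1, p.2.2.1]
  left_inv a := by ext i; fin_cases i <;> rfl
  right_inv p := rfl

open Classical in
lemma Nn_eq {F : Type} [Field F] [Fintype F] (y : Fin 6 → F) :
    Nn y = ∑ a3 : F, ∑ a4 : F, ∑ a5 : F, ∑ a1 : F, ∑ a2 : F, ∑ a0 : F,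
      if a0 * y 0 + a1 * y 1 + a2 * y 2 + a3 * y 3 + a4 * y 4 + a5 * y 5 = 0 ∧
        dd a0 a1 a2 a3 a4 a5 ≠ 0 then (1 : ℤ) else 0 := by
  unfold Nn
  rw [Fintype.sum_equiv (coords F) _
    (fun p => if p.2.2.2.2.2 * y 0 + p.2.2.2.1 * y 1 + p.2.2.2.2.1 * y 2 + p.1 * y 3 +
      p.2.1 * y 4 + p.2.2.1 * y 5 = 0 ∧
        dd p.2.2.2.2.2 p.2.2.2.1 p.2.2.2.2.1 p.1 p.2.1 p.2.2.1 ≠ 0 then (1 : ℤ) else 0)]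
  · simp only [Fintype.sum_prod_type]
  · intro a
    rfl

open Classical in
/-- Case 2. -/
lemma good_case2 {F : Type} [Field F] [Fintype F] (y : Fin 6 → F) (h0 : y 0 = 0) (h2 : y 2 = 0)
    (h4 : y 4 = 0) (h1 : y 1 ≠ 0) : Good y := by
  unfold Good
  rw [Nn_eq]
  have hdt : dt y = 0 ↔ y 5 = 0 := by
    have : dt y = -(y 1 ^ 2 * y 5) := by unfold dt; rw [h0, h2, h4]; ring
    rw [this]; simp [h1]
  simp only [hdt]
  set q : ℤ := (Fintype.card F : ℤ) with hq
  have key : ∀ a3 a4 a5 : F, (∑ a1 : F, ∑ a2 : F, ∑ a0 : F,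
      if a0 * y 0 + a1 * y 1 + a2 * y 2 + a3 * y 3 + a4 * y 4 + a5 * y 5 = 0 ∧
        dd a0 a1 a2 a3 a4 a5 ≠ 0 then (1 : ℤ) else 0) =
      q * (q - 1) + if a3 = 0 then (if a4 = 0 then
        ((if a5 ≠ 0 then (if y 5 = 0 then 0 else q ^ 2) else 0) - q * (q - 1)) else 0) else 0 := by
    intro a3 a4 a5
    have e : ∀ a0 a1 a2 : F, (if a0 * y 0 + a1 * y 1 + a2 * y 2 + a3 * y 3 + a4 * y 4 + a5 * y 5 = 0 ∧
        dd a0 a1 a2 a3 a4 a5 ≠ 0 then (1 : ℤ) else 0) =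
        if a1 = -(a3 * y 3 + a5 * y 5) / y 1 then
          (if dd a0 a1 a2 a3 a4 a5 ≠ 0 then (1 : ℤ) else 0) else 0 := by
      intro a0 a1 a2
      have : a0 * y 0 + a1 * y 1 + a2 * y 2 + a3 * y 3 + a4 * y 4 + a5 * y 5 = 0 ↔
          a1 = -(a3 * y 3 + a5 * y 5) / y 1 := by
        rw [h0, h2, h4, eq_div_iff h1]
        constructor <;> intro h <;> linear_combination h
      rw [this, ite_and]
    simp_rw [e]
    rw [Finset.sum_eq_single (-(a3 * y 3 + a5 * y 5) / y 1)]
    · simp only [if_true]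
      by_cases h : a3 = 0 ∧ a4 = 0
      · obtain ⟨rfl, rfl⟩ := h
        rw [sum_pair0]
        have : -(0 * y 3 + a5 * y 5) / y 1 ≠ 0 ↔ a5 ≠ 0 ∧ y 5 ≠ 0 := by
          simp [h1]
        simp only [this]
        by_cases h5 : a5 = 0 <;> by_cases h6 : y 5 = 0 <;> simp [h5, h6, hq]
      · rw [sum_pair _ _ _ _ h]
        by_cases h3 : a3 = 0
        · have : a4 ≠ 0 := fun h' => h ⟨h3, h'⟩
          simp [h3, this, hq]
        · simp [h3, hq]
    · intro b _ hb
      simp only [if_neg hb, Finset.sum_const_zero]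
    · simp
  simp_rw [key, Finset.sum_add_distrib]
  have s1 : ∀ v : ℤ, (∑ a5 : F, ((if a5 ≠ 0 then v else 0) - q * (q - 1))) =
      (q - 1) * v - q * (q * (q - 1)) := by
    intro v
    have : ∀ a5 : F, (if a5 ≠ 0 then v else 0) = (if a5 ≠ 0 then (1 : ℤ) else 0) * v := by
      intro a5; split_ifs <;> simp
    simp_rw [Finset.sum_sub_distrib, this, ← Finset.sum_mul, sum_ne_const]
    simp [hq]
    ring
  have s2 : (∑ a3 : F, ∑ a4 : F, ∑ a5 : F, if a3 = 0 then (if a4 = 0 then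
        ((if a5 ≠ 0 then (if y 5 = 0 then 0 else q ^ 2) else 0) - q * (q - 1)) else 0) else 0) =
      (q - 1) * (if y 5 = 0 then 0 else q ^ 2) - q * (q * (q - 1)) := by
    rw [Finset.sum_eq_single (0 : F), Finset.sum_eq_single (0 : F)]
    · simp only [if_true]
      rw [s1]
    · intro b _ hb; simp [hb]
    · simp
    · intro b _ hb; simp [hb]
    · simp
  rw [s2]
  simp only [Finset.sum_const, Finset.card_univ, nsmul_eq_mul, ← hq]
  split_ifs <;> ring

open Classical in
lemma sum_lin {F : Type} [Field F] [Fintype F] (b c d : F) (h : ¬ (b = 0 ∧ c = 0 ∧ d = 0)) :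
    (∑ a3 : F, ∑ a4 : F, ∑ a5 : F, if a3 * b + a4 * c + a5 * d = 0 then (1 : ℤ) else 0) =
      (Fintype.card F : ℤ) ^ 2 := by
  by_cases hd : d = 0
  · by_cases hc : c = 0
    · have hb : b ≠ 0 := fun hb => h ⟨hb, hc, hd⟩
      subst hd hc
      simp [hb, sq]
    · subst hd
      have : ∀ a3 a4 a5 : F, a3 * b + a4 * c + a5 * 0 = 0 ↔ a4 = -(a3 * b) / c := by
        intro a3 a4 a5
        rw [eq_div_iff hc]
        constructor <;> intro h <;> linear_combination h
      simp_rw [this]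
      simp [sq]
  · have : ∀ a3 a4 a5 : F, a3 * b + a4 * c + a5 * d = 0 ↔ a5 = -(a3 * b + a4 * c) / d := by
      intro a3 a4 a5
      rw [eq_div_iff hd]
      constructor <;> intro h <;> linear_combination h
    simp_rw [this]
    simp [sq]

open Classical in
/-- Case 1. -/
lemma good_case1 {F : Type} [Field F] [Fintype F] (y : Fin 6 → F) (h0 : y 0 = 0) (h1 : y 1 = 0)
    (h2 : y 2 = 0) (hy : ¬ (y 3 = 0 ∧ y 4 = 0 ∧ y 5 = 0)) : Good y := by
  unfold Good
  rw [Nn_eq]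
  have hdt : dt y = 0 := by unfold dt; rw [h0, h1, h2]; ring
  rw [if_pos hdt]
  set q : ℤ := (Fintype.card F : ℤ) with hq
  have key : ∀ a3 a4 a5 : F, (∑ a1 : F, ∑ a2 : F, ∑ a0 : F,
      if a0 * y 0 + a1 * y 1 + a2 * y 2 + a3 * y 3 + a4 * y 4 + a5 * y 5 = 0 ∧
        dd a0 a1 a2 a3 a4 a5 ≠ 0 then (1 : ℤ) else 0) =
      ((if a3 * y 3 + a4 * y 4 + a5 * y 5 = 0 then 1 else 0) -
        if a3 = 0 then (if a4 = 0 then (if a5 = 0 then 1 else 0) else 0) else 0)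
        * (q ^ 2 * (q - 1)) := by
    intro a3 a4 a5
    have e : ∀ a0 a1 a2 : F, (if a0 * y 0 + a1 * y 1 + a2 * y 2 + a3 * y 3 + a4 * y 4 + a5 * y 5 = 0 ∧
        dd a0 a1 a2 a3 a4 a5 ≠ 0 then (1 : ℤ) else 0) =
        (if a3 * y 3 + a4 * y 4 + a5 * y 5 = 0 then 1 else 0) *
          (if dd a0 a1 a2 a3 a4 a5 ≠ 0 then (1 : ℤ) else 0) := by
      intro a0 a1 a2
      rw [h0, h1, h2, ite_and]
      by_cases h : dd a0 a1 a2 a3 a4 a5 = 0 <;> simp [h]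
    simp_rw [e, ← Finset.mul_sum]
    by_cases h : a3 = 0 ∧ a4 = 0
    · obtain ⟨rfl, rfl⟩ := h
      simp_rw [sum_pair0]
      by_cases h5 : a5 = 0
      · simp [h5]
      · have : ∀ x : F, (if a5 ≠ 0 ∧ x ≠ 0 then (Fintype.card F : ℤ) ^ 2 else 0) =
            (if x ≠ 0 then (1 : ℤ) else 0) * q ^ 2 := by
          intro x; by_cases hx : x = 0 <;> simp [h5, hx, hq]
        simp_rw [this, ← Finset.sum_mul, sum_ne_const]
        simp only [h5, if_true, if_false, ← hq]
        ring
    · simp_rw [sum_pair _ _ _ _ h]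
      have : (if a3 = 0 then (if a4 = 0 then (if a5 = 0 then (1 : ℤ) else 0) else 0) else 0) = 0 := by
        by_cases h3 : a3 = 0
        · have : a4 ≠ 0 := fun h' => h ⟨h3, h'⟩
          simp [this]
        · simp [h3]
      rw [this]
      simp only [Finset.sum_const, Finset.card_univ, nsmul_eq_mul, ← hq]
      ring
  simp_rw [key, ← Finset.sum_mul, Finset.sum_sub_distrib, sum_lin _ _ _ hy]
  simp [← hq]
  ring

/-- An isotropic point for `y 0 = 0`. -/
lemma good_of_zero {F : Type} [Field F] [Fintype F] (y : Fin 6 → F) (h0 : y 0 = 0)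
    (hy : y ≠ 0) : Good y := by
  have main : ∀ y : Fin 6 → F, y 0 = 0 → y 1 ≠ 0 → Good y := by
    intro y h0 h1
    apply good_shear12 (-(y 2) / y 1)
    apply good_shear02 (-(y 4 + -(y 2) / y 1 * y 3) / y 1)
    apply good_case2
    · simpa using h0
    · simp [h0]; field_simp; ring
    · simp; field_simp; ring
    · simpa using h1
  by_cases h1 : y 1 = 0
  · by_cases h2 : y 2 = 0
    · apply good_case1 y h0 h1 h2
      rintro ⟨h3, h4, h5⟩
      apply hy
      ext i
      fin_cases i <;> simp [h0, h1, h2, h3, h4, h5]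
    · apply good_swap12
      apply main
      · simpa using h0
      · simpa using h2
  · exact main y h0 h1

/-- The quadratic form of `M y`. -/
def Q {F : Type} [Field F] (y : Fin 6 → F) (v : Fin 3 → F) : F :=
  v 0 ^ 2 * y 0 + 2 * v 0 * v 1 * y 1 + 2 * v 0 * v 2 * y 2 + v 1 ^ 2 * y 3 +
    2 * v 1 * v 2 * y 4 + v 2 ^ 2 * y 5

lemma exists_isotropic {F : Type} [Field F] [Fintype F] (y : Fin 6 → F) :
    ∃ v : Fin 3 → F, v ≠ 0 ∧ Q y v = 0 := by
  classical
  let f : MvPolynomial (Fin 3) F := ∑ i : Fin 3, ∑ j : Fin 3,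
    MvPolynomial.C (M y i j) * (MvPolynomial.X i * MvPolynomial.X j)
  have hf : f.totalDegree < Fintype.card (Fin 3) := by
    have : f.totalDegree ≤ 2 := by
      apply MvPolynomial.totalDegree_finsetSum_le
      intro i _
      apply MvPolynomial.totalDegree_finsetSum_le
      intro j _
      refine (MvPolynomial.totalDegree_mul _ _).trans ?_
      refine (add_le_add le_rfl (MvPolynomial.totalDegree_mul _ _)).trans ?_
      simp
    simp; omega
  have he : ∀ v, MvPolynomial.eval v f = Q y v := by
    intro v
    simp [f, Fin.sum_univ_three, M, Q]
    ring
  obtain ⟨p, hp⟩ := CharP.exists F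
  have hpp : p.Prime := CharP.char_is_prime F p
  have hdvd := char_dvd_card_solutions p hf
  have hone : 1 < Fintype.card { x : Fin 3 → F // MvPolynomial.eval x f = 0 } := by
    refine lt_of_lt_of_le hpp.one_lt (Nat.le_of_dvd ?_ hdvd)
    rw [Fintype.card_pos_iff]
    exact ⟨⟨0, by rw [he]; simp [Q]⟩⟩
  haveI := Fintype.one_lt_card_iff_nontrivial.1 hone
  obtain ⟨⟨v, hv⟩, hne⟩ := exists_ne
    (⟨0, by rw [he]; simp [Q]⟩ : { x : Fin 3 → F // MvPolynomial.eval x f = 0 })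
  refine ⟨v, fun h => hne (Subtype.ext h), ?_⟩
  rw [← he, hv]

lemma good_all {F : Type} [Field F] [Fintype F] (y : Fin 6 → F) (hy : y ≠ 0) : Good y := by
  have main : ∀ y : Fin 6 → F, y ≠ 0 → ∀ v : Fin 3 → F, v 0 ≠ 0 → Q y v = 0 → Good y := by
    intro y hy v h0 hv
    apply good_shear0 (v 1 / v 0) (v 2 / v 0)
    apply good_of_zero
    · simp
      unfold Q at hv
      field_simp
      linear_combination hv
    · intro h
      have e0 := congrFun h 0
      have e1 := congrFun h 1
      have e2 := congrFun h 2
      have e3 := congrFun h 3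
      have e4 := congrFun h 4
      have e5 := congrFun h 5
      simp at e0 e1 e2 e3 e4 e5
      simp only [e3, e4, e5, mul_zero, add_zero] at e0 e1 e2
      simp only [e1, e2, mul_zero, add_zero] at e0
      apply hy
      ext i
      fin_cases i <;> simp [e0, e1, e2, e3, e4, e5]
  obtain ⟨v, hv, hQ⟩ := exists_isotropic y
  have main1 : ∀ y : Fin 6 → F, y ≠ 0 → ∀ v : Fin 3 → F, v 1 ≠ 0 → Q y v = 0 → Good y := by
    intro y hy v h0 hv
    apply good_swap01
    refine main _ ?_ ![v 1, v 0, v 2] (by simpa using h0) ?_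
    · intro h
      apply hy
      have e0 := congrFun h 0
      have e1 := congrFun h 1
      have e2 := congrFun h 2
      have e3 := congrFun h 3
      have e4 := congrFun h 4
      have e5 := congrFun h 5
      simp at e0 e1 e2 e3 e4 e5
      ext i
      fin_cases i <;> simp [e0, e1, e2, e3, e4, e5]
    · rw [← hv]; simp [Q]; ring
  by_cases h0 : v 0 = 0
  · by_cases h1 : v 1 = 0
    · have h2 : v 2 ≠ 0 := by
        intro h2
        apply hv
        ext i
        fin_cases i <;> simp [h0, h1, h2]
      apply good_swap12
      refine main1 _ ?_ ![v 0, v 2, v 1] (by simpa using h2) ?_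
      · intro h
        apply hy
        have e0 := congrFun h 0
        have e1 := congrFun h 1
        have e2 := congrFun h 2
        have e3 := congrFun h 3
        have e4 := congrFun h 4
        have e5 := congrFun h 5
        simp at e0 e1 e2 e3 e4 e5
        ext i
        fin_cases i <;> simp [e0, e1, e2, e3, e4, e5]
      · rw [← hQ]; simp [Q]; ring
    · exact main1 y hy v h1 hQ
  · exact main y hy v h0 hQ

lemma numConics_mul_s6 {F : Type} [Field F] [Fintype F] (y : Fin 6 → F) :
    (numConics (squab y) IsNonsingular : ℤ) * ((Fintype.card F : ℤ) - 1) = Nn y := by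
  classical
  set S : Set (Submodule F (Fin 6 → F)) := {P : Submodule F (Fin 6 → F) |
    ∃ a : Fin 6 → F, a ≠ 0 ∧ a ∈ squab y ∧ IsNonsingular a ∧ P = Submodule.span F {a}} with hS
  have hN : Nn y = (Nat.card {a : Fin 6 → F // Bform a y = 0 ∧ disc a ≠ 0} : ℤ) := by
    unfold Nn
    rw [Nat.card_eq_fintype_card, Fintype.card_subtype, Finset.card_filter]
    push_cast
    rfl
  have hdisc : ∀ (c : F) (a : Fin 6 → F), disc (c • a) = c ^ 3 * disc a := by
    intro c a; simp [disc]; ring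
  choose r hr using fun P : S => P.2
  have hu : ((Nat.card Fˣ : ℕ) : ℤ) = (Fintype.card F : ℤ) - 1 := by
    rw [Nat.card_eq_fintype_card, Fintype.card_units]
    have : 0 < Fintype.card F := Fintype.card_pos
    push_cast [Nat.cast_sub this]
    rfl
  rw [hN, ← hu]
  unfold numConics
  rw [← hS, ← Nat.card_coe_set_eq, ← Nat.cast_mul, ← Nat.card_prod]
  congr 1
  let f : S × Fˣ → {a : Fin 6 → F // Bform a y = 0 ∧ disc a ≠ 0} := fun p =>
    ⟨(p.2 : F) • r p.1, (squab y).smul_mem _ (hr p.1).2.1, by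
      rw [hdisc]
      exact mul_ne_zero (pow_ne_zero _ p.2.ne_zero) (hr p.1).2.2.1⟩
  apply Nat.card_eq_of_bijective f
  constructor
  · rintro ⟨P, u⟩ ⟨P', u'⟩ h
    have h' : (u : F) • r P = (u' : F) • r P' := congrArg Subtype.val h
    have hPP : P = P' := by
      apply Subtype.ext
      rw [(hr P).2.2.2, (hr P').2.2.2]
      rw [← Submodule.span_singleton_smul_eq u.isUnit, h',
        Submodule.span_singleton_smul_eq u'.isUnit]
    subst hPP
    have : (u : F) = u' := smul_left_injective F (hr P).1 h'
    rw [Units.ext this]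
  · rintro ⟨a, ha, hd⟩
    have ha0 : a ≠ 0 := by
      rintro rfl
      apply hd; simp [disc]
    let P : S := ⟨Submodule.span F {a}, a, ha0, ha, hd, rfl⟩
    have hP := (hr P).2.2.2
    have hm : a ∈ Submodule.span F {r P} := by
      rw [← hP]
      exact Submodule.mem_span_singleton_self a
    obtain ⟨c, hc⟩ := Submodule.mem_span_singleton.1 hm
    have hc0 : c ≠ 0 := by
      rintro rfl
      apply ha0; rw [← hc, zero_smul]
    exact ⟨(P, Units.mk0 c hc0), Subtype.ext hc⟩

lemma det_M {F : Type} [Field F] (y : Fin 6 → F) : (M y).det = dt y := by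
  simp [M, dt, Matrix.det_fin_three]; ring

end helpers

/-- every squab contains exactly `q^4 - q^2` nonsingular conics if its point has
rank at most 2 (i.e. lies on the secant variety of the Veronese surface), and exactly `q^4`
nonsingular conics if its point has rank 3. -/
theorem squab_nonsingular_counts (F : Type) [Field F] [Fintype F] (q : ℕ)
    (hq : Fintype.card F = q) (y : Fin 6 → F) (hy : y ≠ 0) :
    ((M y).rank ≤ 2 → numConics (squab y) IsNonsingular = q ^ 4 - q ^ 2) ∧
    ((M y).rank = 3 → numConics (squab y) IsNonsingular = q ^ 4) := by
  have hg := good_all y hy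
  have hn := numConics_mul_s6 y
  unfold Good at hg
  rw [hg] at hn
  have hq1 : 1 < q := hq ▸ Fintype.one_lt_card
  rw [hq] at hn
  have hne : ((q : ℤ) - 1) ≠ 0 := by
    have : (1 : ℤ) < q := by exact_mod_cast hq1
    omega
  rw [mul_comm] at hn
  have hn' := mul_left_cancel₀ hne hn
  constructor
  · intro hr
    have hdt : dt y = 0 := by
      by_contra h
      rw [← det_M] at h
      have := Matrix.rank_of_det_ne_zero h
      simp at this
      omega
    rw [if_pos hdt] at hn'
    have hle : q ^ 2 ≤ q ^ 4 := Nat.pow_le_pow_right (by omega) (by norm_num)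
    zify [hle]
    exact hn'
  · intro hr
    have hdt : dt y ≠ 0 := by
      rw [← det_M]
      intro h
      obtain ⟨v, hv, hv0⟩ := Matrix.exists_mulVec_eq_zero_iff.2 h
      have h1 := LinearMap.finrank_range_add_finrank_ker (M y).mulVecLin
      have h2 : Module.finrank F (LinearMap.range (M y).mulVecLin) = 3 := hr
      rw [h2] at h1
      have h3 : Module.finrank F (LinearMap.ker (M y).mulVecLin) = 0 := by
        simp at h1
        simpa using h1
      rw [Submodule.finrank_eq_zero] at h3
      have : v ∈ LinearMap.ker (M y).mulVecLin := by simpa using hv0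
      rw [h3] at this
      exact hv (by simpa using this)
    rw [if_neg hdt] at hn'
    zify
    simpa using hn'
end Conics
end

section
/- Let q be an odd prime power and F = GF(q). Let W and W' be 5-dimensional F-subspaces of F^6 (squabs of conics). If W and W' contain the same number of double-line conics and the same number of nonsingular conics, then W and W' are projectively equivalent. -/
open Matrix

namespace Conics

/-- The (upper triangular) matrix of the quadratic form `f_a`, so that `f_a(X) = Xᵀ U X`. -/
def upperMat {F : Type} [Field F] (a : Fin 6 → F) : Matrix (Fin 3) (Fin 3) F :=
  !![a 0, a 1, a 2; 0, a 3, a 4; 0, 0, a 5]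

/-- The coefficient vector of the quadratic form `X ↦ Xᵀ N X`. -/
def coeffOf {F : Type} [Field F] (N : Matrix (Fin 3) (Fin 3) F) : Fin 6 → F :=
  ![N 0 0, N 0 1 + N 1 0, N 0 2 + N 2 0, N 1 1, N 1 2 + N 2 1, N 2 2]

/-- The coefficient vector of `f_a ∘ A`, i.e. of the quadratic form obtained from `f_a` by the
invertible linear substitution of variables `X ↦ A·X`. -/
def subst {F : Type} [Field F] (A : Matrix (Fin 3) (Fin 3) F) (a : Fin 6 → F) : Fin 6 → F :=
  coeffOf (Aᵀ * upperMat a * A)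

/-- Two linear systems of conics `W`, `W'` are projectively equivalent if there exists an
invertible matrix `A` with `W' = {coefficient vector of f_a ∘ A : a ∈ W}`. -/
def ProjEquiv {F : Type} [Field F] (W W' : Submodule F (Fin 6 → F)) : Prop :=
  ∃ A : Matrix (Fin 3) (Fin 3) F, IsUnit A ∧
    (W' : Set (Fin 6 → F)) = subst A '' (W : Set (Fin 6 → F))

section aux
variable {F : Type} [Field F]

lemma subst_one (a : Fin 6 → F) : subst 1 a = a := by
  ext i
  fin_cases i <;> simp [subst, coeffOf, upperMat]

lemma coeffOf_conj (N B : Matrix (Fin 3) (Fin 3) F) :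
    coeffOf (Bᵀ * upperMat (coeffOf N) * B) = coeffOf (Bᵀ * N * B) := by
  ext i
  fin_cases i <;>
    simp [coeffOf, upperMat, Matrix.mul_apply, Fin.sum_univ_three] <;> ring

lemma subst_subst (A B : Matrix (Fin 3) (Fin 3) F) (a : Fin 6 → F) :
    subst B (subst A a) = subst (A * B) a := by
  unfold subst
  rw [coeffOf_conj, Matrix.transpose_mul]
  simp only [Matrix.mul_assoc]

lemma subst_add (A : Matrix (Fin 3) (Fin 3) F) (a b : Fin 6 → F) :
    subst A (a + b) = subst A a + subst A b := by
  ext i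
  fin_cases i <;>
    simp [subst, coeffOf, upperMat, Matrix.mul_apply, Fin.sum_univ_three] <;> ring

lemma subst_smul (A : Matrix (Fin 3) (Fin 3) F) (c : F) (a : Fin 6 → F) :
    subst A (c • a) = c • subst A a := by
  ext i
  fin_cases i <;>
    simp [subst, coeffOf, upperMat, Matrix.mul_apply, Fin.sum_univ_three] <;> ring

lemma subst_mulLin (A : Matrix (Fin 3) (Fin 3) F) (l : Fin 3 → F) :
    subst A (mulLin l l) = mulLin (Aᵀ.mulVec l) (Aᵀ.mulVec l) := by
  ext i
  fin_cases i <;>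
    simp [subst, coeffOf, upperMat, mulLin, Matrix.mul_apply, Matrix.mulVec, dotProduct,
      Fin.sum_univ_three] <;> ring

lemma two_disc (N : Matrix (Fin 3) (Fin 3) F) :
    2 * disc (coeffOf N) = (N + Nᵀ).det := by
  rw [Matrix.det_fin_three]
  simp [disc, coeffOf]
  ring

lemma coeffOf_upperMat (a : Fin 6 → F) : coeffOf (upperMat a) = a := by
  ext i
  fin_cases i <;> simp [coeffOf, upperMat]

lemma two_disc_subst (A : Matrix (Fin 3) (Fin 3) F) (a : Fin 6 → F) :
    2 * disc (subst A a) = A.det ^ 2 * (2 * disc a) := by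
  unfold subst
  rw [two_disc]
  have h : Aᵀ * upperMat a * A + (Aᵀ * upperMat a * A)ᵀ
      = Aᵀ * (upperMat a + (upperMat a)ᵀ) * A := by
    simp only [Matrix.transpose_mul, Matrix.transpose_transpose, Matrix.mul_add, Matrix.add_mul,
      Matrix.mul_assoc]
  rw [h, Matrix.det_mul, Matrix.det_mul, Matrix.det_transpose, ← two_disc, coeffOf_upperMat]
  ring

/-- The substitution as a linear equivalence. -/
noncomputable def substEquiv (A : (Matrix (Fin 3) (Fin 3) F)ˣ) :
    (Fin 6 → F) ≃ₗ[F] (Fin 6 → F) where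
  toFun := subst A.1
  map_add' := subst_add _
  map_smul' := subst_smul _
  invFun := subst (A⁻¹).1
  left_inv a := by
    rw [subst_subst]
    simp [subst_one]
  right_inv a := by
    rw [subst_subst]
    simp [subst_one]

lemma ProjEquiv.symm {W W' : Submodule F (Fin 6 → F)} (h : ProjEquiv W W') : ProjEquiv W' W := by
  obtain ⟨A, ⟨u, rfl⟩, hA⟩ := h
  refine ⟨(u⁻¹).1, Units.isUnit _, ?_⟩
  rw [hA, Set.image_image]
  simp [subst_subst, subst_one]

lemma ProjEquiv.trans {W W' W'' : Submodule F (Fin 6 → F)} (h : ProjEquiv W W')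
    (h' : ProjEquiv W' W'') : ProjEquiv W W'' := by
  obtain ⟨A, hA, hA'⟩ := h
  obtain ⟨B, hB, hB'⟩ := h'
  refine ⟨A * B, hA.mul hB, ?_⟩
  rw [hB', hA', Set.image_image]
  simp [subst_subst]

lemma Bform_eq_trace (a y : Fin 6 → F) : Bform a y = (upperMat a * M y).trace := by
  simp [Bform, upperMat, M, Matrix.trace_fin_three]
  ring

lemma trace_coeffOf (N : Matrix (Fin 3) (Fin 3) F) (y : Fin 6 → F) :
    (upperMat (coeffOf N) * M y).trace = (N * M y).trace := by
  simp [coeffOf, upperMat, M, Matrix.trace_fin_three, Matrix.mul_apply, Fin.sum_univ_three]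
  ring

lemma Bform_subst (A : Matrix (Fin 3) (Fin 3) F) (a y : Fin 6 → F) :
    Bform (subst A a) y = (upperMat a * (A * M y * Aᵀ)).trace := by
  rw [Bform_eq_trace, subst, trace_coeffOf, Matrix.mul_assoc, Matrix.mul_assoc, Matrix.trace_mul_comm]
  simp only [Matrix.mul_assoc]

lemma step {y y' : Fin 6 → F} (A : Matrix (Fin 3) (Fin 3) F) (c : F) (hA : A.det ≠ 0)
    (hc : c ≠ 0) (h : c • M y' = A * M y * Aᵀ) : ProjEquiv (squab y) (squab y') := by
  have hu : IsUnit A := (Matrix.isUnit_iff_isUnit_det A).2 (isUnit_iff_ne_zero.2 hA)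
  apply ProjEquiv.symm
  have key : ∀ a, Bform (subst A a) y = c * Bform a y' := by
    intro a
    rw [Bform_subst, ← h, Bform_eq_trace]
    simp
  obtain ⟨u, rfl⟩ := hu
  refine ⟨u.1, Units.isUnit _, ?_⟩
  ext b
  constructor
  · intro hb
    refine ⟨subst (u⁻¹).1 b, ?_, by rw [subst_subst]; simp [subst_one]⟩
    have := key (subst (u⁻¹).1 b)
    rw [subst_subst] at this
    simp only [Units.inv_mul, subst_one] at this
    have hb' : Bform b y = 0 := hb
    rw [hb'] at this
    have h0 : Bform (subst (u⁻¹).1 b) y' = 0 := by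
      rcases mul_eq_zero.1 this.symm with h | h
      · exact absurd h hc
      · exact h
    exact h0
  · rintro ⟨a, ha, rfl⟩
    have ha' : Bform a y' = 0 := ha
    show Bform (subst u.1 a) y = 0
    rw [key, ha', mul_zero]

lemma numConics_congr {W W' : Submodule F (Fin 6 → F)} (h : ProjEquiv W W')
    (T : (Fin 6 → F) → Prop)
    (hT : ∀ A : Matrix (Fin 3) (Fin 3) F, IsUnit A → ∀ a, T a → T (subst A a)) :
    numConics W T = numConics W' T := by
  obtain ⟨A, ⟨u, rfl⟩, hA⟩ := h
  unfold numConics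
  have : {P : Submodule F (Fin 6 → F) |
      ∃ a : Fin 6 → F, a ≠ 0 ∧ a ∈ W' ∧ T a ∧ P = Submodule.span F {a}} =
      (Submodule.map (substEquiv u).toLinearMap) '' {P : Submodule F (Fin 6 → F) |
    ∃ a : Fin 6 → F, a ≠ 0 ∧ a ∈ W ∧ T a ∧ P = Submodule.span F {a}} := by
    ext P
    constructor
    · rintro ⟨b, hb, hbW, hbT, rfl⟩
      have hb2 : b ∈ subst u.1 '' (W : Set (Fin 6 → F)) := hA ▸ hbW
      obtain ⟨a, haW, rfl⟩ := hb2
      refine ⟨Submodule.span F {a}, ⟨a, ?_, haW, ?_, rfl⟩, ?_⟩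
      · rintro rfl
        exact hb (map_zero (substEquiv u))
      · have := hT (u⁻¹).1 (Units.isUnit _) _ hbT
        rwa [subst_subst, Units.mul_inv, subst_one] at this
      · rw [Submodule.map_span, Set.image_singleton]
        rfl
    · rintro ⟨_, ⟨a, ha, haW, haT, rfl⟩, rfl⟩
      refine ⟨subst u.1 a, ?_, ?_, hT _ (Units.isUnit _) _ haT, ?_⟩
      · intro h0
        exact ha ((substEquiv u).map_eq_zero_iff.1 h0)
      · have : subst u.1 a ∈ (W' : Set (Fin 6 → F)) := by
          rw [hA]
          exact ⟨a, haW, rfl⟩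
        exact this
      · rw [Submodule.map_span, Set.image_singleton]
        rfl
  rw [this, Set.ncard_image_of_injective]
  exact Submodule.map_injective_of_injective (substEquiv u).injective

lemma dbl_inv (A : Matrix (Fin 3) (Fin 3) F) (hA : IsUnit A) (a : Fin 6 → F)
    (h : IsDoubleLine a) : IsDoubleLine (subst A a) := by
  obtain ⟨c, l, hc, hl, rfl⟩ := h
  refine ⟨c, Aᵀ.mulVec l, hc, ?_, by rw [subst_smul, subst_mulLin]⟩
  intro h0
  apply hl
  have hA' : IsUnit Aᵀ := by rwa [Matrix.isUnit_transpose]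
  exact Matrix.mulVec_injective_iff_isUnit.2 hA' (by rw [h0, Matrix.mulVec_zero])

lemma ns_inv (h2 : (2 : F) ≠ 0) (A : Matrix (Fin 3) (Fin 3) F) (hA : IsUnit A) (a : Fin 6 → F)
    (h : IsNonsingular a) : IsNonsingular (subst A a) := by
  intro h0
  have := two_disc_subst A a
  rw [h0, mul_zero] at this
  have hd : A.det ≠ 0 := ((Matrix.isUnit_iff_isUnit_det A).1 hA).ne_zero
  exact (mul_ne_zero (pow_ne_zero 2 hd) (mul_ne_zero h2 h)) this.symm

lemma exists_squab (W : Submodule F (Fin 6 → F)) (hW : Module.finrank F W = 5) :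
    ∃ y : Fin 6 → F, y ≠ 0 ∧ W = squab y := by
  have hlt : W < ⊤ := by
    rw [lt_top_iff_ne_top]
    rintro rfl
    simp at hW
  obtain ⟨f, hf, hle⟩ := Submodule.exists_le_ker_of_lt_top W hlt
  have hrange : Module.finrank F (LinearMap.range f) = 1 := by
    rw [LinearMap.range_eq_top.2 (LinearMap.surjective hf)]
    simp
  have hker := LinearMap.finrank_range_add_finrank_ker f
  have hk5 : Module.finrank F (LinearMap.ker f) = 5 := by
    simp at hker
    omega
  have heq : W = LinearMap.ker f := Submodule.eq_of_le_of_finrank_eq hle (by rw [hW, hk5])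
  have hfa : ∀ a, f a = Bform a (fun i => f (Pi.single i 1)) := by
    intro a
    have : a = ∑ i, a i • (Pi.single i 1 : Fin 6 → F) := by
      ext j
      simp [Finset.sum_apply, Pi.single_apply]
    conv_lhs => rw [this]
    rw [map_sum]
    simp [Bform, Fin.sum_univ_six]
  refine ⟨fun i => f (Pi.single i 1), ?_, ?_⟩
  · intro h0
    apply hf
    ext a
    have := congrFun h0 a
    simpa using this
  · rw [heq]
    ext a
    rw [LinearMap.mem_ker, hfa]
    rfl

/-- diagonal point -/
def dg (a b c : F) : Fin 6 → F := ![a, 0, 0, b, 0, c]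

lemma dg_eq {y : Fin 6 → F} (h2 : (2 : F) ≠ 0) :
    ∃ a b c : F, ProjEquiv (squab y) (squab (dg a b c)) := by
  have : Invertible (2 : F) := invertibleOfNonzero h2
  have hs : (M y)ᵀ = M y := by
    ext i j
    fin_cases i <;> fin_cases j <;> simp [M]
  have hB : LinearMap.IsSymm (Matrix.toBilin' (M y)) := by
    refine ⟨fun v w => ?_⟩
    simp only [Matrix.toBilin'_apply', RingHom.id_apply]
    rw [dotProduct_comm, Matrix.dotProduct_mulVec w, ← Matrix.mulVec_transpose, hs]
  obtain ⟨v0, hv0⟩ := LinearMap.BilinForm.exists_orthogonal_basis hB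
  let v : Module.Basis (Fin 3) F (Fin 3 → F) := v0.reindex (finCongr (by simp))
  have hv : ∀ i j : Fin 3, i ≠ j → v i ⬝ᵥ (M y).mulVec (v j) = 0 := by
    intro i j hij
    rw [← Matrix.toBilin'_apply']
    have := (LinearMap.isOrthoᵢ_def.1 hv0) (finCongr (by simp) i) (finCongr (by simp) j)
      (by simpa using hij)
    simpa [v, Module.Basis.reindex_apply] using this
  let A : Matrix (Fin 3) (Fin 3) F := Matrix.of (fun i j => v i j)
  have hent : ∀ i j, (A * M y * Aᵀ) i j = v i ⬝ᵥ (M y).mulVec (v j) := by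
    intro i j
    rw [Matrix.mul_assoc]
    simp only [Matrix.mul_apply, dotProduct, Matrix.mulVec, A, Matrix.transpose_apply,
      Matrix.of_apply]
  have hA : A.det ≠ 0 := by
    have hli : LinearIndependent F A.row := v.linearIndependent
    have := Matrix.linearIndependent_rows_iff_isUnit.1 hli
    exact ((Matrix.isUnit_iff_isUnit_det A).1 this).ne_zero
  refine ⟨(A * M y * Aᵀ) 0 0, (A * M y * Aᵀ) 1 1, (A * M y * Aᵀ) 2 2,
    step A 1 hA one_ne_zero ?_⟩
  rw [one_smul]
  ext i j
  by_cases hij : i = j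
  · subst hij
    fin_cases i <;> simp [M, dg]
  · refine Eq.trans ?_ ((hent i j).trans (hv i j hij)).symm
    fin_cases i <;> fin_cases j <;> simp [M, dg] at hij ⊢

lemma dg_ne {a b c : F} {y : Fin 6 → F} (hy : y ≠ 0)
    (h : ProjEquiv (squab y) (squab (dg a b c))) : ¬ (a = 0 ∧ b = 0 ∧ c = 0) := by
  rintro ⟨rfl, rfl, rfl⟩
  obtain ⟨A, ⟨u, rfl⟩, hA⟩ := h.symm
  apply hy
  have hall : ∀ b, Bform b y = 0 := by
    intro b
    have : b ∈ (squab y : Set (Fin 6 → F)) := by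
      rw [hA]
      refine ⟨subst (u⁻¹).1 b, ?_, by rw [subst_subst]; simp [subst_one]⟩
      show Bform _ _ = 0
      simp [Bform, dg]
    exact this
  ext i
  have := hall (Pi.single i 1)
  fin_cases i <;> simpa [Bform, Pi.single_apply] using this

lemma swap01 (a b c : F) : ProjEquiv (squab (dg a b c)) (squab (dg b a c)) := by
  refine step !![0, 1, 0; 1, 0, 0; 0, 0, 1] 1 ?_ one_ne_zero ?_
  · simp [Matrix.det_fin_three]
  · ext i j
    fin_cases i <;> fin_cases j <;>
      simp [M, dg, Matrix.mul_apply, Fin.sum_univ_three]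

lemma swap12 (a b c : F) : ProjEquiv (squab (dg a b c)) (squab (dg a c b)) := by
  refine step !![1, 0, 0; 0, 0, 1; 0, 1, 0] 1 ?_ one_ne_zero ?_
  · simp [Matrix.det_fin_three]
  · ext i j
    fin_cases i <;> fin_cases j <;>
      simp [M, dg, Matrix.mul_apply, Fin.sum_univ_three]

/-- rank one -/
def N1 : Fin 6 → F := ![1, 0, 0, 0, 0, 0]
/-- rank two, hyperbolic -/
def N2h : Fin 6 → F := ![0, 1, 0, 0, 0, 0]
/-- rank two, elliptic -/
def N2e (n : F) : Fin 6 → F := ![1, 0, 0, -n, 0, 0]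
/-- rank three -/
def N3 : Fin 6 → F := ![0, 1, 0, 0, 0, 1]

lemma to_N1 {a : F} (ha : a ≠ 0) : ProjEquiv (squab (dg a 0 0)) (squab N1) := by
  refine step 1 a (by simp) ha ?_
  ext i j
  fin_cases i <;> fin_cases j <;> simp [M, dg, N1]

lemma to_N2h (h2 : (2 : F) ≠ 0) {a b s : F} (ha : a ≠ 0) (hb : b ≠ 0) (h : -(b / a) = s * s) :
    ProjEquiv (squab (dg a b 0)) (squab N2h) := by
  have hs : s ≠ 0 := by
    rintro rfl
    simp [ha, hb] at h
  have hb' : b = - a * (s * s) := by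
    rw [← h]
    field_simp
  refine step !![s, 1, 0; s, -1, 0; 0, 0, 1] (2 * a * s ^ 2) ?_ ?_ ?_
  · simp [Matrix.det_fin_three]
    intro h0
    apply mul_ne_zero h2 hs
    linear_combination -h0
  · positivity
  · subst hb'
    ext i j
    fin_cases i <;> fin_cases j <;>
      simp [M, dg, N2h, Matrix.mul_apply, Fin.sum_univ_three] <;> ring

lemma to_N2e {a b s n : F} (ha : a ≠ 0) (hb : b ≠ 0)
    (h : -(b / a) = s * s * n) :
    ProjEquiv (squab (dg a b 0)) (squab (N2e n)) := by
  have hs : s ≠ 0 := by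
    rintro rfl
    simp [ha, hb] at h
  have hb' : b = - a * (s * s * n) := by
    rw [← h]
    field_simp
  refine step !![s, 0, 0; 0, 1, 0; 0, 0, 1] (a * s ^ 2) ?_ ?_ ?_
  · simp [Matrix.det_fin_three, hs]
  · positivity
  · subst hb'
    ext i j
    fin_cases i <;> fin_cases j <;>
      simp [M, dg, N2e, Matrix.mul_apply, Fin.sum_univ_three] <;> ring

lemma to_N3 (h2 : (2 : F) ≠ 0) {a b c x y : F} (ha : a ≠ 0) (hb : b ≠ 0) (hc : c ≠ 0)
    (h : b * x ^ 2 + c * y ^ 2 = -a) :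
    ProjEquiv (squab (dg a b c)) (squab N3) := by
  have h1 : ProjEquiv (squab (dg a b c)) (squab (dg a (-a) (-(a * b * c)))) := by
    refine step !![1, 0, 0; 0, x, y; 0, -c * y, b * x] 1 ?_ one_ne_zero ?_
    · simp [Matrix.det_fin_three]
      intro h0
      apply ha
      linear_combination -h0 + h
    · ext i j
      fin_cases i <;> fin_cases j <;>
        simp [M, dg, Matrix.mul_apply, Fin.sum_univ_three]
      · linear_combination -h
      · ring
      · ring
      · linear_combination -(b * c) * h
  refine h1.trans ?_
  refine step !![1, 1, 0; -(b * c) / 2, (b * c) / 2, 0; 0, 0, 1] (-(a * b * c)) ?_ ?_ ?_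
  · simp [Matrix.det_fin_three]
    intro h0
    apply mul_ne_zero hb hc
    have h0' : b * c * 2 = 0 := by
      field_simp at h0
      linear_combination h0
    exact (mul_eq_zero.1 h0').resolve_right h2
  · simp [ha, hb, hc]
  · ext i j
    fin_cases i <;> fin_cases j <;>
      simp [M, dg, N3, Matrix.mul_apply, Fin.sum_univ_three] <;> field_simp <;> ring

lemma classify [Fintype F] (h2 : (2 : F) ≠ 0) (hodd : Fintype.card F % 2 = 1) (n : F)
    (hn : ¬ IsSquare n) {y : Fin 6 → F} (hy : y ≠ 0) :
    ProjEquiv (squab y) (squab N1) ∨ ProjEquiv (squab y) (squab N2h) ∨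
    ProjEquiv (squab y) (squab (N2e n)) ∨ ProjEquiv (squab y) (squab N3) := by
  classical
  obtain ⟨a, b, c, h⟩ := dg_eq (y := y) h2
  have hne := dg_ne hy h
  have r2 : ∀ a b : F, a ≠ 0 → b ≠ 0 → ProjEquiv (squab y) (squab (dg a b 0)) →
      ProjEquiv (squab y) (squab N2h) ∨ ProjEquiv (squab y) (squab (N2e n)) := by
    intro a b ha hb h
    by_cases hsq : IsSquare (-(b / a))
    · obtain ⟨s, hs⟩ := hsq
      exact Or.inl (h.trans (to_N2h h2 ha hb hs))
    · right
      have hn0 : n ≠ 0 := by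
        rintro rfl
        exact hn (IsSquare.zero)
      have hba : -(b / a) ≠ 0 := by simp [ha, hb]
      have hq : IsSquare (-(b / a) * n) := by
        rw [← quadraticChar_one_iff_isSquare (mul_ne_zero hba hn0), map_mul,
          quadraticChar_neg_one_iff_not_isSquare.2 hsq, quadraticChar_neg_one_iff_not_isSquare.2 hn]
        norm_num
      obtain ⟨r, hr⟩ := hq
      refine h.trans (to_N2e (s := r / n) ha hb ?_)
      have : -(b / a) = r * r / n := by
        rw [← hr]
        field_simp
      rw [this]
      field_simp
  by_cases ha : a = 0 <;> by_cases hb : b = 0 <;> by_cases hc : c = 0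
  · exact absurd ⟨ha, hb, hc⟩ hne
  · subst ha hb
    exact Or.inl (h.trans ((swap12 _ _ _).trans ((swap01 _ _ _).trans (to_N1 hc))))
  · subst ha hc
    exact Or.inl (h.trans ((swap01 _ _ _).trans (to_N1 hb)))
  · subst ha
    have := r2 b c hb hc (h.trans ((swap01 _ _ _).trans (swap12 _ _ _)))
    tauto
  · subst hb hc
    exact Or.inl (h.trans (to_N1 ha))
  · subst hb
    have := r2 a c ha hc (h.trans (swap12 _ _ _))
    tauto
  · subst hc
    have := r2 a b ha hb h
    tauto
  · right; right; right
    obtain ⟨x, z, hxz⟩ := FiniteField.exists_root_sum_quadratic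
      (f := Polynomial.C b * Polynomial.X ^ 2 + Polynomial.C 0 * Polynomial.X + Polynomial.C a)
      (g := Polynomial.C c * Polynomial.X ^ 2 + Polynomial.C 0 * Polynomial.X + Polynomial.C 0)
      (Polynomial.degree_quadratic hb) (Polynomial.degree_quadratic hc) hodd
    simp at hxz
    exact h.trans (to_N3 h2 ha hb hc (x := x) (y := z) (by linear_combination hxz))

lemma card_fiber [Fintype F] {α β : Type} [DecidableEq α] [DecidableEq β] [AddCommGroup α]
    [Module F α] (S : Finset α)
    (f : α → β) (h0 : ∀ x ∈ S, x ≠ 0) (hS : ∀ x ∈ S, ∀ u : Fˣ, u.1 • x ∈ S)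
    (hf : ∀ x ∈ S, ∀ y ∈ S, f x = f y ↔ ∃ u : Fˣ, y = u.1 • x) :
    S.card = (S.image f).card * (Fintype.card F - 1) := by
  classical
  rw [Finset.card_eq_sum_card_image f S]
  apply Finset.sum_const_nat
  intro b hb
  obtain ⟨x, hx, rfl⟩ := Finset.mem_image.1 hb
  have : S.filter (fun a => f a = f x) = Finset.univ.image (fun u : Fˣ => u.1 • x) := by
    ext y
    simp only [Finset.mem_filter, Finset.mem_image, Finset.mem_univ, true_and]
    constructor
    · rintro ⟨hy, hxy⟩
      obtain ⟨u, hu⟩ := (hf x hx y hy).1 hxy.symm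
      exact ⟨u, hu.symm⟩
    · rintro ⟨u, rfl⟩
      exact ⟨hS x hx u, ((hf x hx _ (hS x hx u)).2 ⟨u, rfl⟩).symm⟩
  rw [this, Finset.card_image_of_injective, Finset.card_univ, Fintype.card_units]
  intro u v huv
  exact Units.ext (smul_left_injective F (h0 x hx) huv)

lemma span_eq_iff {a b : Fin 6 → F} :
    Submodule.span F {a} = Submodule.span F {b} ↔ ∃ u : Fˣ, b = u.1 • a := by
  rw [Submodule.span_singleton_eq_span_singleton]
  constructor
  · rintro ⟨u, hu⟩
    exact ⟨u, hu.symm⟩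
  · rintro ⟨u, hu⟩
    exact ⟨u, hu.symm⟩

lemma ns_count [Fintype F] [DecidableEq F] (y : Fin 6 → F) :
    (Finset.univ.filter (fun a : Fin 6 → F => Bform a y = 0 ∧ disc a ≠ 0)).card
      = numConics (squab y) IsNonsingular * (Fintype.card F - 1) := by
  classical
  rw [card_fiber (F := F) _ (fun a => Submodule.span F {a})]
  · congr 1
    unfold numConics
    rw [← Set.ncard_coe_finset]
    congr 1
    ext P
    simp only [Finset.coe_image, Finset.coe_filter, Finset.mem_univ, true_and]
    constructor
    · rintro ⟨a, ⟨h1, h2⟩, rfl⟩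
      refine ⟨a, ?_, h1, h2, rfl⟩
      rintro rfl
      simp [disc] at h2
    · rintro ⟨a, h0, h1, h2, rfl⟩
      exact ⟨a, ⟨h1, h2⟩, rfl⟩
  · intro a ha
    rintro rfl
    rw [Finset.mem_filter] at ha
    simp [disc] at ha
  · intro a ha u
    simp only [Finset.mem_filter, Finset.mem_univ, true_and] at ha ⊢
    refine ⟨(squab y).smul_mem _ ha.1, ?_⟩
    have : disc (u.1 • a) = u.1 ^ 3 * disc a := by
      simp [disc]
      ring
    rw [this]
    exact mul_ne_zero (pow_ne_zero _ u.ne_zero) ha.2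
  · intro a _ b _
    exact span_eq_iff

lemma mulLin_smul_s7 (c : F) (l : Fin 3 → F) : mulLin (c • l) (c • l) = c ^ 2 • mulLin l l := by
  ext i
  fin_cases i <;> simp [mulLin] <;> ring

lemma mulLin_ne {l : Fin 3 → F} (hl : l ≠ 0) : mulLin l l ≠ 0 := by
  intro h
  apply hl
  have e0 := congrFun h 0
  have e3 := congrFun h 3
  have e5 := congrFun h 5
  simp [mulLin] at e0 e3 e5
  ext i
  fin_cases i <;> simpa

lemma mulLin_inj (h2 : (2 : F) ≠ 0) {l m : Fin 3 → F} (hm : m ≠ 0) {c : F}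
    (h : mulLin m m = c • mulLin l l) :
    ∃ u : Fˣ, m = u.1 • l := by
  have e : ∀ i j, m i * m j = c * (l i * l j) := by
    have e0 := congrFun h 0
    have e1 := congrFun h 1
    have e2 := congrFun h 2
    have e3 := congrFun h 3
    have e4 := congrFun h 4
    have e5 := congrFun h 5
    simp [mulLin] at e0 e1 e2 e3 e4 e5
    intro i j
    fin_cases i <;> fin_cases j <;> simp <;> first
      | assumption
      | (apply mul_left_cancel₀ h2; first
          | linear_combination e1
          | linear_combination e2
          | linear_combination e4)
  obtain ⟨k, hk⟩ := Function.ne_iff.1 hm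
  simp only [Pi.zero_apply] at hk
  have hk2 : c * l k * l k ≠ 0 := by
    rw [mul_assoc, ← e]
    exact mul_ne_zero hk hk
  have hc : c ≠ 0 := fun h => hk2 (by simp [h])
  have hlk : l k ≠ 0 := fun h => hk2 (by simp [h])
  refine ⟨Units.mk0 (c * l k / m k) (div_ne_zero (mul_ne_zero hc hlk) hk), ?_⟩
  ext i
  simp only [Units.val_mk0, Pi.smul_apply, smul_eq_mul]
  field_simp
  linear_combination e i k

lemma dbl_count [Fintype F] [DecidableEq F] (h2 : (2 : F) ≠ 0) (y : Fin 6 → F) :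
    (Finset.univ.filter (fun l : Fin 3 → F => Bform (mulLin l l) y = 0)).card
      = numConics (squab y) IsDoubleLine * (Fintype.card F - 1) + 1 := by
  classical
  have h0 : (0 : Fin 3 → F) ∈
      (Finset.univ.filter (fun l : Fin 3 → F => Bform (mulLin l l) y = 0)) := by
    rw [Finset.mem_filter]
    simp [mulLin, Bform]
  rw [← Finset.card_erase_add_one h0]
  congr 1
  rw [card_fiber (F := F) _ (fun l => Submodule.span F {mulLin l l})]
  · congr 1
    unfold numConics
    rw [← Set.ncard_coe_finset]
    congr 1
    ext P
    simp only [Finset.coe_image]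
    constructor
    · rintro ⟨l, hl, rfl⟩
      simp at hl
      refine ⟨mulLin l l, mulLin_ne hl.2, hl.1, ⟨1, l, one_ne_zero, hl.2, by simp⟩, rfl⟩
    · rintro ⟨a, _, h1, ⟨c, l, hc, hl, rfl⟩, rfl⟩
      refine ⟨l, ?_, ?_⟩
      · simp [hl]
        have := (squab y).smul_mem c⁻¹ h1
        rw [smul_smul, inv_mul_cancel₀ hc, one_smul] at this
        exact this
      · exact span_eq_iff.2 ⟨Units.mk0 c hc, rfl⟩
  · intro a ha
    exact Finset.ne_of_mem_erase ha
  · intro a ha u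
    simp at ha ⊢
    refine ⟨ha.1, ?_⟩
    rw [mulLin_smul_s7]
    exact (squab y).smul_mem _ ha.2
  · intro a ha b hb
    rw [span_eq_iff]
    constructor
    · rintro ⟨u, hu⟩
      exact mulLin_inj h2 (Finset.ne_of_mem_erase hb) hu
    · rintro ⟨u, rfl⟩
      exact ⟨u ^ 2, by rw [mulLin_smul_s7]; simp⟩

lemma lin_count [Fintype F] [DecidableEq F] {α : Type} [Fintype α] (c d : α → F) :
    (Finset.univ.filter (fun p : α × F => c p.1 * p.2 + d p.1 = 0)).card +
      (Finset.univ.filter (fun p : α => c p = 0)).card =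
    Fintype.card α +
      Fintype.card F * (Finset.univ.filter (fun p : α => c p = 0 ∧ d p = 0)).card := by
  classical
  have key : ∀ p : α, (∑ x : F, if c p * x + d p = 0 then 1 else 0) + (if c p = 0 then 1 else 0)
      = 1 + Fintype.card F * (if c p = 0 ∧ d p = 0 then 1 else 0) := by
    intro p
    by_cases hc : c p = 0
    · by_cases hd : d p = 0
      · simp [hc, hd, add_comm]
      · simp [hc, hd]
    · have : ∀ x : F, c p * x + d p = 0 ↔ x = -d p / c p := by
        intro x
        rw [eq_div_iff hc]
        constructor
        · intro h
          linear_combination h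
        · intro h
          linear_combination h
      simp [hc, this]
  rw [Finset.card_filter, Finset.card_filter, Finset.card_filter, Fintype.sum_prod_type,
    ← Finset.sum_add_distrib, Finset.mul_sum, ← Finset.card_univ, Finset.card_eq_sum_ones,
    ← Finset.sum_add_distrib]
  exact Finset.sum_congr rfl (fun p _ => key p)

lemma ns_N1_lt [Fintype F] [DecidableEq F] :
    (Finset.univ.filter (fun a : Fin 6 → F => Bform a N1 = 0 ∧ disc a ≠ 0)).card
      + Fintype.card F ^ 4 < Fintype.card F ^ 5 := by
  classical
  set q := Fintype.card F with hq
  have hlin := lin_count (F := F) (α := F × F × F × F) (fun p => -p.2.1 ^ 2)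
    (fun p => p.1 * p.2.1 * p.2.2.1 - p.2.2.2 * p.1 ^ 2)
  have e1 : (Finset.univ.filter (fun p : F × F × F × F => -p.2.1 ^ 2 = 0)).card = q ^ 3 := by
    have : q ^ 3 = Fintype.card (F × F × F) := by
      simp [Fintype.card_prod, ← hq]
      ring
    rw [this, ← Finset.card_univ]
    refine Finset.card_bij' (fun p _ => (p.1, p.2.2.1, p.2.2.2)) (fun p _ => (p.1, 0, p.2.1, p.2.2))
      ?_ ?_ ?_ ?_
    · simp
    · simp
    · rintro ⟨a, b, c, d⟩ h
      simp at h
      simp [h]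
    · simp
  have e2 : q ^ 2 + 1 ≤ (Finset.univ.filter (fun p : F × F × F × F => -p.2.1 ^ 2 = 0 ∧
      p.1 * p.2.1 * p.2.2.1 - p.2.2.2 * p.1 ^ 2 = 0)).card := by
    have : q ^ 2 + 1 = Fintype.card (Option (F × F)) := by
      simp [Fintype.card_prod, ← hq]
      ring
    rw [this, ← Finset.card_univ]
    refine Finset.card_le_card_of_injOn
      (fun o => o.elim (0, 0, 0, 1) (fun p => (p.1, 0, p.2, 0))) ?_ ?_
    · rintro (_ | p) _ <;> simp
    · rintro (_ | p) _ (_ | p') _ h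
      · rfl
      · simp at h
      · simp at h
      · simp at h
        rw [Option.some_inj]
        exact Prod.ext h.1 h.2
  have e3 : (Finset.univ.filter (fun a : Fin 6 → F => Bform a N1 = 0 ∧ disc a ≠ 0)).card =
      (Finset.univ.filter (fun p : (F × F × F × F) × F => ¬ (-p.1.2.1 ^ 2 * p.2 +
        (p.1.1 * p.1.2.1 * p.1.2.2.1 - p.1.2.2.2 * p.1.1 ^ 2) = 0))).card := by
    have hd : ∀ a : Fin 6 → F, a 0 = 0 → disc a = -a 2 ^ 2 * a 3 +
        (a 1 * a 2 * a 4 - a 5 * a 1 ^ 2) := by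
      intro a h
      simp [disc, h]
      ring
    refine Finset.card_bij' (fun a _ => ((a 1, a 2, a 4, a 5), a 3))
      (fun p _ => ![0, p.1.1, p.1.2.1, p.2, p.1.2.2.1, p.1.2.2.2]) ?_ ?_ ?_ ?_
    · intro a ha
      simp only [Finset.mem_filter, Finset.mem_univ, true_and] at ha ⊢
      have h0 : a 0 = 0 := by simpa [Bform, N1] using ha.1
      rw [← hd a h0]
      exact ha.2
    · rintro p hp
      simp only [Finset.mem_filter, Finset.mem_univ, true_and] at hp ⊢
      refine ⟨by simp [Bform, N1], ?_⟩
      rw [hd _ (by simp)]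
      simpa using hp
    · intro a ha
      simp only [Finset.mem_filter, Finset.mem_univ, true_and] at ha
      have h0 : a 0 = 0 := by simpa [Bform, N1] using ha.1
      ext i
      fin_cases i <;> simp [h0]
    · rintro ⟨⟨a, b, c, d⟩, e⟩ _
      simp
  have e4 := Finset.card_filter_add_card_filter_not (s := (Finset.univ : Finset ((F × F × F × F) × F)))
    (fun p => -p.1.2.1 ^ 2 * p.2 + (p.1.1 * p.1.2.1 * p.1.2.2.1 - p.1.2.2.2 * p.1.1 ^ 2) = 0)
  rw [e3]
  rw [e1] at hlin
  simp only [Finset.card_univ, Fintype.card_prod, ← hq] at hlin e4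
  have hq1 : 1 < q := Fintype.one_lt_card
  have e2' := Nat.mul_le_mul_left q e2
  ring_nf at *
  omega

lemma le_ns_N3 [Fintype F] [DecidableEq F] (h2 : (2 : F) ≠ 0) :
    Fintype.card F ^ 5 ≤
    (Finset.univ.filter (fun a : Fin 6 → F => Bform a N3 = 0 ∧ disc a ≠ 0)).card
      + Fintype.card F ^ 4 := by
  classical
  have h4 : (4 : F) ≠ 0 := by
    have : (4 : F) = 2 * 2 := by norm_num
    rw [this]
    exact mul_ne_zero h2 h2
  set q := Fintype.card F with hq
  -- p = (a2, a3, a4, t)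
  have hlin := lin_count (F := F) (α := F × F × F × F)
    (fun p => 4 * p.2.1 * p.2.2.2 - p.2.2.1 ^ 2)
    (fun p => - p.2.2.2 * p.1 * p.2.2.1 - p.2.1 * p.1 ^ 2 - p.2.2.2 ^ 3)
  have e1 : q ^ 3 ≤ (Finset.univ.filter (fun p : F × F × F × F =>
      4 * p.2.1 * p.2.2.2 - p.2.2.1 ^ 2 = 0)).card := by
    have : q ^ 3 = Fintype.card (F × F × F) := by
      simp [Fintype.card_prod, ← hq]
      ring
    rw [this, ← Finset.card_univ]
    refine Finset.card_le_card_of_injOn (fun p => if p.2.1 = 0 then (p.1, p.2.2, 0, 0) else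
      (p.1, p.2.2 ^ 2 / (4 * p.2.1), p.2.2, p.2.1)) ?_ ?_
    · rintro ⟨a, u, v⟩ _
      by_cases hu : u = 0
      · simp [hu]
      · simp [hu]
        field_simp
        simp
    · rintro ⟨a, u, v⟩ _ ⟨a', u', v'⟩ _ h
      by_cases hu : u = 0 <;> by_cases hu' : u' = 0 <;> simp [hu, hu'] at h ⊢
      · exact h
      · exact absurd h.2.2.2.symm hu'
      · tauto
  have e2 : (Finset.univ.filter (fun p : F × F × F × F =>
      4 * p.2.1 * p.2.2.2 - p.2.2.1 ^ 2 = 0 ∧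
      - p.2.2.2 * p.1 * p.2.2.1 - p.2.1 * p.1 ^ 2 - p.2.2.2 ^ 3 = 0)).card ≤ q ^ 2 := by
    have : q ^ 2 = Fintype.card (F × F) := by
      simp [Fintype.card_prod, ← hq]
      ring
    rw [this, ← Finset.card_univ]
    have hz : ∀ a2 a3 a4 : F, 4 * a3 * 0 - a4 ^ 2 = 0 → - 0 * a2 * a4 - a3 * a2 ^ 2 - 0 ^ 3 = 0 →
        a4 = 0 ∧ a3 * a2 = 0 := by
      intro a2 a3 a4 h h'
      refine ⟨by simpa using h, ?_⟩
      simp at h'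
      rcases h' with h' | h' <;> simp [h']
    have hnz : ∀ a2 a3 a4 t : F, t ≠ 0 → 4 * a3 * t - a4 ^ 2 = 0 →
        - t * a2 * a4 - a3 * a2 ^ 2 - t ^ 3 = 0 →
        a4 ≠ 0 ∧ a2 = - 2 * t ^ 2 / a4 ∧ a3 = a4 ^ 2 / (4 * t) := by
      intro a2 a3 a4 t ht h h'
      have hs : (a2 * a4 + 2 * t ^ 2) ^ 2 = 0 := by
        linear_combination (-4 * t) * h' - a2 ^ 2 * h
      have hs' : a2 * a4 + 2 * t ^ 2 = 0 := by simpa using hs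
      have ha4 : a4 ≠ 0 := by
        rintro rfl
        simp [h2, ht] at hs'
      refine ⟨ha4, ?_, ?_⟩
      · field_simp
        linear_combination hs'
      · field_simp
        linear_combination h
    refine Finset.card_le_card_of_injOn (fun p => if p.2.2.2 = 0 then (p.2.1, p.1) else
      (p.2.2.2, p.2.2.1)) (by simp) ?_
    rintro ⟨a2, a3, a4, t⟩ hp ⟨b2, b3, b4, s⟩ hp' h
    simp only [Finset.coe_filter, Finset.mem_univ, true_and] at hp hp'
    obtain ⟨hp1, hp2⟩ := hp
    obtain ⟨hp1', hp2'⟩ := hp'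
    simp only at hp1 hp2 hp1' hp2'
    by_cases ht : t = 0 <;> by_cases hs : s = 0
    · subst ht hs
      have := hz _ _ _ hp1 hp2
      have := hz _ _ _ hp1' hp2'
      simp at h ⊢
      simp [*]
    · subst ht
      have h1 := hz _ _ _ hp1 hp2
      have h3 := hnz _ _ _ _ hs hp1' hp2'
      simp [hs] at h
      rw [h.1, h.2] at h1
      exact absurd h1.2 (mul_ne_zero hs h3.1)
    · subst hs
      have h1 := hz _ _ _ hp1' hp2'
      have h3 := hnz _ _ _ _ ht hp1 hp2
      simp [ht] at h
      rw [← h.1, ← h.2] at h1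
      exact absurd h1.2 (mul_ne_zero ht h3.1)
    · have h1 := hnz _ _ _ _ ht hp1 hp2
      have h3 := hnz _ _ _ _ hs hp1' hp2'
      simp [ht, hs] at h
      rw [h1.2.1, h1.2.2, h3.2.1, h3.2.2, h.1, h.2]
  have e3 : (Finset.univ.filter (fun a : Fin 6 → F => Bform a N3 = 0 ∧ disc a ≠ 0)).card =
      (Finset.univ.filter (fun p : (F × F × F × F) × F =>
        ¬ ((4 * p.1.2.1 * p.1.2.2.2 - p.1.2.2.1 ^ 2) * p.2 +
        (- p.1.2.2.2 * p.1.1 * p.1.2.2.1 - p.1.2.1 * p.1.1 ^ 2 - p.1.2.2.2 ^ 3) = 0))).card := by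
    have hd : ∀ a : Fin 6 → F, a 1 = - a 5 → disc a = (4 * a 3 * a 5 - a 4 ^ 2) * a 0 +
        (- a 5 * a 2 * a 4 - a 3 * a 2 ^ 2 - a 5 ^ 3) := by
      intro a h
      simp only [disc, h]
      ring
    have hb : ∀ a : Fin 6 → F, Bform a N3 = 0 → a 1 = - a 5 := by
      intro a h
      simp [Bform, N3] at h
      linear_combination h
    refine Finset.card_bij' (fun a _ => ((a 2, a 3, a 4, a 5), a 0))
      (fun p _ => ![p.2, -p.1.2.2.2, p.1.1, p.1.2.1, p.1.2.2.1, p.1.2.2.2]) ?_ ?_ ?_ ?_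
    · intro a ha
      simp only [Finset.mem_filter, Finset.mem_univ, true_and] at ha ⊢
      rw [← hd a (hb a ha.1)]
      exact ha.2
    · rintro p hp
      simp only [Finset.mem_filter, Finset.mem_univ, true_and] at hp ⊢
      refine ⟨by simp [Bform, N3], ?_⟩
      rw [hd _ (by simp)]
      simpa using hp
    · intro a ha
      simp only [Finset.mem_filter, Finset.mem_univ, true_and] at ha
      have h0 := hb a ha.1
      ext i
      fin_cases i <;> simp [h0]
    · rintro ⟨⟨a, b, c, d⟩, e⟩ _
      simp
  have e4 := Finset.card_filter_add_card_filter_not (s := (Finset.univ : Finset ((F × F × F × F) × F)))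
    (fun p => (4 * p.1.2.1 * p.1.2.2.2 - p.1.2.2.1 ^ 2) * p.2 +
        (- p.1.2.2.2 * p.1.1 * p.1.2.2.1 - p.1.2.1 * p.1.1 ^ 2 - p.1.2.2.2 ^ 3) = 0)
  rw [e3]
  simp only [Finset.card_univ, Fintype.card_prod, ← hq] at hlin e4
  have e2' := Nat.mul_le_mul_left q e2
  have p1 : q * (q * (q * q)) = q ^ 4 := by ring
  have p2 : q * (q * (q * q)) * q = q ^ 5 := by ring
  have p3 : q * q ^ 2 = q ^ 3 := by ring
  rw [p2] at e4
  rw [p1] at hlin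
  rw [p3] at e2'
  omega

lemma d_N1 [Fintype F] [DecidableEq F] :
    (Finset.univ.filter (fun l : Fin 3 → F => Bform (mulLin l l) N1 = 0)).card
      = Fintype.card F ^ 2 := by
  have : Fintype.card F ^ 2 = Fintype.card (F × F) := by
    simp [Fintype.card_prod]
    ring
  rw [this, ← Finset.card_univ]
  refine Finset.card_bij' (fun l _ => (l 1, l 2)) (fun p _ => ![0, p.1, p.2]) ?_ ?_ ?_ ?_
  · simp
  · intro p _
    rw [Finset.mem_filter]
    simp [Bform, mulLin, N1]
  · intro l hl
    rw [Finset.mem_filter] at hl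
    have : l 0 = 0 := by simpa [Bform, mulLin, N1] using hl.2
    ext i
    fin_cases i <;> simp [this]
  · simp

lemma d_N3 [Fintype F] [DecidableEq F] (h2 : (2 : F) ≠ 0) :
    (Finset.univ.filter (fun l : Fin 3 → F => Bform (mulLin l l) N3 = 0)).card
      = Fintype.card F ^ 2 := by
  have : Fintype.card F ^ 2 = Fintype.card (F × F) := by
    simp [Fintype.card_prod]
    ring
  rw [this, ← Finset.card_univ]
  have hb : ∀ l : Fin 3 → F, Bform (mulLin l l) N3 = 2 * l 0 * l 1 + l 2 ^ 2 := by
    intro l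
    simp [Bform, mulLin, N3]
    ring
  refine Finset.card_bij' (fun l _ => if l 0 = 0 then (0, l 1) else (l 0, l 2))
    (fun p _ => if p.1 = 0 then ![0, p.2, 0] else ![p.1, - p.2 ^ 2 / (2 * p.1), p.2]) ?_ ?_ ?_ ?_
  · simp
  · rintro ⟨u, v⟩ _
    rw [Finset.mem_filter, hb]
    refine ⟨Finset.mem_univ _, ?_⟩
    by_cases hu : u = 0
    · simp [hu]
    · simp [hu]
      field_simp
      ring
  · intro l hl
    rw [Finset.mem_filter, hb] at hl
    have hl' := hl.2
    by_cases h0 : l 0 = 0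
    · rw [h0] at hl'
      have : l 2 = 0 := by simpa using hl'
      ext i
      fin_cases i <;> simp [h0, this]
    · ext i
      fin_cases i <;> simp [h0]
      field_simp
      linear_combination -hl'
  · rintro ⟨u, v⟩ _
    by_cases hu : u = 0
    · simp [hu]
    · simp [hu]

lemma d_N2h [Fintype F] [DecidableEq F] :
    Fintype.card F ^ 2 <
    (Finset.univ.filter (fun l : Fin 3 → F => Bform (mulLin l l) N2h = 0)).card := by
  have : Fintype.card F ^ 2 + 1 = Fintype.card (Option (F × F)) := by
    simp [Fintype.card_prod]
    ring
  rw [← Nat.succ_le_iff, Nat.succ_eq_add_one, this, ← Finset.card_univ]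
  refine Finset.card_le_card_of_injOn
    (fun o => o.elim ![1, 0, 0] (fun p => ![0, p.1, p.2])) ?_ ?_
  · rintro (_ | p) _ <;> simp [Bform, mulLin, N2h]
  · rintro (_ | p) _ (_ | p') _ h
    · rfl
    · have := congrFun h 0
      simp at this
    · have := congrFun h 0
      simp at this
    · have h1 := congrFun h 1
      have h2 := congrFun h 2
      simp at h1 h2
      rw [Option.some_inj]
      exact Prod.ext h1 h2

lemma d_N2e [Fintype F] [DecidableEq F] (n : F) (hn : ¬ IsSquare n) :
    (Finset.univ.filter (fun l : Fin 3 → F => Bform (mulLin l l) (N2e n) = 0)).card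
      < Fintype.card F ^ 2 := by
  have hq1 : 1 < Fintype.card F := Fintype.one_lt_card
  refine lt_of_le_of_lt (b := Fintype.card F) ?_ (by nlinarith)
  rw [← Finset.card_univ]
  have hb : ∀ l : Fin 3 → F, Bform (mulLin l l) (N2e n) = 0 → l 0 = 0 ∧ l 1 = 0 := by
    intro l h
    simp [Bform, mulLin, N2e] at h
    have h1 : l 1 = 0 := by
      by_contra h1
      apply hn
      refine ⟨l 0 / l 1, ?_⟩
      field_simp
      linear_combination -h
    rw [h1] at h
    exact ⟨by simpa using h, h1⟩
  refine Finset.card_le_card_of_injOn (fun l => l 2) (by simp) ?_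
  intro l hl m hm h
  simp only [Finset.coe_filter, Finset.mem_univ, true_and] at hl hm
  have := hb l hl
  have := hb m hm
  ext i
  fin_cases i <;> simp_all
end aux

/-- two squabs of conics with the same number of double lines and the same number
of nonsingular conics are projectively equivalent, `q` odd. -/
theorem squabs_equiv_of_same_doubles_and_nonsingular (F : Type) [Field F] [Fintype F] (q : ℕ)
    (hq : Fintype.card F = q) (hodd : Odd q)
    (W W' : Submodule F (Fin 6 → F))
    (hW : Module.finrank F W = 5) (hW' : Module.finrank F W' = 5)
    (hd : numConics W IsDoubleLine = numConics W' IsDoubleLine)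
    (hn : numConics W IsNonsingular = numConics W' IsNonsingular) :
    ProjEquiv W W' := by
  classical
  have hodd' : Fintype.card F % 2 = 1 := by
    rw [hq]
    exact Nat.odd_iff.1 hodd
  have hchar : ringChar F ≠ 2 := by
    intro h
    have := FiniteField.even_card_iff_char_two.1 h
    omega
  have h2 : (2 : F) ≠ 0 := Ring.two_ne_zero hchar
  obtain ⟨n, hnsq⟩ := FiniteField.exists_nonsquare hchar
  obtain ⟨y, hy, rfl⟩ := exists_squab W hW
  obtain ⟨y', hy', rfl⟩ := exists_squab W' hW'
  have hD : ∀ z z' : Fin 6 → F, ProjEquiv (squab y) (squab z) → ProjEquiv (squab y') (squab z') →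
      (Finset.univ.filter (fun l : Fin 3 → F => Bform (mulLin l l) z = 0)).card =
      (Finset.univ.filter (fun l : Fin 3 → F => Bform (mulLin l l) z' = 0)).card := by
    intro z z' hz hz'
    rw [dbl_count h2, dbl_count h2, ← numConics_congr hz _ dbl_inv,
      ← numConics_congr hz' _ dbl_inv, hd]
  have hN : ∀ z z' : Fin 6 → F, ProjEquiv (squab y) (squab z) → ProjEquiv (squab y') (squab z') →
      (Finset.univ.filter (fun a : Fin 6 → F => Bform a z = 0 ∧ disc a ≠ 0)).card =
      (Finset.univ.filter (fun a : Fin 6 → F => Bform a z' = 0 ∧ disc a ≠ 0)).card := by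
    intro z z' hz hz'
    rw [ns_count, ns_count, ← numConics_congr hz _ (ns_inv h2),
      ← numConics_congr hz' _ (ns_inv h2), hn]
  have n1 := ns_N1_lt (F := F)
  have n3 := le_ns_N3 (F := F) h2
  have d1 := d_N1 (F := F)
  have d3 := d_N3 (F := F) h2
  have dh := d_N2h (F := F)
  have de := d_N2e n hnsq
  rcases classify h2 hodd' n hnsq hy with h | h | h | h <;>
    rcases classify h2 hodd' n hnsq hy' with h' | h' | h' | h' <;>
    first
      | exact h.trans h'.symm
      | (exfalso
         have t1 := hD _ _ h h'
         have t2 := hN _ _ h h'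
         omega)
end Conics
end
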